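/- arXiv:2605.16729 — 2 statements merged into one kernel-verified Lean document; each statement's English description precedes it below -/
import Mathlib

section
/- Let R(x) = ∑_{i=0}^e a_i x^{p^i} ∈ F_q[x] with e ≥ 1 and a_e ≠ 0, and set V := {u ∈ 𝔽 : R(u) + R*(u) = 0}. Then the following are equivalent: (1) there exist b_0,…,b_e ∈ F_q with b_0·b_e ≠ 0 and t ∈ F_q such that, writing F(x) := ∑_{i=0}^e b_i x^{p^i}, one has F*(1) = 0, {x ∈ 𝔽 : F*(x) = 0} ⊆ F_q, a_i = ∑_{j=0}^{e−i}(b_j b_{j+i})^{p^{−j}} for all 1 ≤ i ≤ e, and a_0 = γ_F + F*(t)² where γ_F := ∑_{0≤i<j≤e} b_i^{p^{−i}} b_j^{p^{−j}}; (2) V ⊆ F_{q²} and Tr_{F_{q²}/F_p}((u^q + u)·R(u)) = 0 for all u ∈ V. -/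
open Finset

open scoped Classical

noncomputable section

/-- Length-two Witt vectors, with the operations specialised to characteristic two. -/
def W2 (R : Type*) := R × R

namespace W2

variable {R : Type*} [CommRing R]

instance : Zero (W2 R) := ⟨((0, 0) : R × R)⟩

instance : Add (W2 R) := ⟨fun x y => ((x.1 + y.1, x.2 + y.2 + x.1 * y.1) : R × R)⟩

instance [CharP R 2] : Neg (W2 R) := ⟨fun x => ((x.1, x.2 + x.1 * x.1) : R × R)⟩

theorem fst_add (x y : W2 R) : (x + y).1 = x.1 + y.1 := rfl
theorem snd_add (x y : W2 R) : (x + y).2 = x.2 + y.2 + x.1 * y.1 := rfl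
theorem fst_zero : (0 : W2 R).1 = 0 := rfl
theorem snd_zero : (0 : W2 R).2 = 0 := rfl
theorem fst_neg [CharP R 2] (x : W2 R) : (-x).1 = x.1 := rfl
theorem snd_neg [CharP R 2] (x : W2 R) : (-x).2 = x.2 + x.1 * x.1 := rfl

instance [CharP R 2] : AddCommGroup (W2 R) where
  add := (· + ·)
  zero := 0
  neg := Neg.neg
  add_assoc a b c := Prod.ext_iff.mpr (by
    constructor <;> simp only [fst_add, snd_add] <;> ring)
  zero_add a := Prod.ext_iff.mpr (by
    constructor <;> simp [fst_add, snd_add, fst_zero, snd_zero])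
  add_zero a := Prod.ext_iff.mpr (by
    constructor <;> simp [fst_add, snd_add, fst_zero, snd_zero])
  add_comm a b := Prod.ext_iff.mpr (by
    constructor <;> simp only [fst_add, snd_add] <;> ring)
  neg_add_cancel a := Prod.ext_iff.mpr (by
    constructor
    · simp only [fst_add, fst_neg, fst_zero]
      exact CharTwo.add_self_eq_zero a.1
    · simp only [snd_add, snd_neg, snd_zero, fst_neg]
      rw [show a.2 + a.1 * a.1 + a.2 + a.1 * a.1
            = (a.2 + a.2) + (a.1 * a.1 + a.1 * a.1) by ring]
      rw [CharTwo.add_self_eq_zero, CharTwo.add_self_eq_zero, add_zero])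
  nsmul := nsmulRec
  zsmul := zsmulRec

/-- Frobenius on length-two Witt vectors (characteristic two). -/
def frob (x : W2 R) : W2 R := ((x.1 ^ 2, x.2 ^ 2) : R × R)

/-- The Witt-vector trace `Tr_{q/2} = ∑_{i=0}^{n-1} Frobⁱ`. -/
def tr [CharP R 2] (n : ℕ) (x : W2 R) : W2 R := ∑ i ∈ Finset.range n, frob^[i] x

/-- The additive character of `W₂(𝔽₂)` determined by `ξ₂(1,0) = I`
(for `I` a fixed primitive fourth root of unity), evaluated on Witt vectors
whose components lie in the prime field `𝔽₂ = {0,1}`. -/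
def xi (I : ℂ) (x : W2 R) : ℂ := (if x.1 = 0 then 1 else I) * (if x.2 = 0 then 1 else -1)

end W2

variable {K : Type*}

/-- The absolute trace `Tr_{q/2} : 𝔽_q → 𝔽₂`, computed inside `K` (here `q = 2^n`). -/
def tr2 [Field K] (n : ℕ) (x : K) : K := ∑ i ∈ Finset.range n, x ^ 2 ^ i

/-- The relative trace `Tr_{q/p} : 𝔽_q → 𝔽_p ⊆ 𝔽_q`, computed inside `K`
(here `q = p^m`). -/
def trp [Field K] (p m : ℕ) (x : K) : K := ∑ i ∈ Finset.range m, x ^ p ^ i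

/-- The character `ψ_q(x) = (-1)^{Tr_{q/2}(x)}`. -/
def psiq [Field K] (n : ℕ) (x : K) : ℂ := if tr2 n x = 0 then 1 else -1

/-- The map `Q_q(x) = ξ₂(Tr_{q/2}(x,0))` on Witt vectors of length two. -/
def Qq [Field K] [CharP K 2] (I : ℂ) (n : ℕ) (x : K) : ℂ :=
  W2.xi I (W2.tr n (((x, 0) : K × K) : W2 K))

/-- The unique `2^j`-th root in a perfect field of characteristic two. -/
def rt (L : Type*) [Field L] [ExpChar L 2] [PerfectRing L 2] (j : ℕ) (x : L) : L :=
  (fun y => (frobeniusEquiv L 2).symm y)^[j] x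

/-- Evaluation of the `𝔽_p`-linearised polynomial `∑_{i=0}^{e} c_i x^{p^i}`. -/
def Lpoly [Field K] (p e : ℕ) (c : ℕ → K) (x : K) : K :=
  ∑ i ∈ Finset.range (e + 1), c i * x ^ p ^ i

/-- The adjoint `f^*(x) = ∑_{i=0}^{e} (c_i x)^{p^{-i}}` (with `p = 2^k`). -/
def adj [Field K] [ExpChar K 2] [PerfectRing K 2] (k e : ℕ) (c : ℕ → K) (x : K) : K :=
  ∑ i ∈ Finset.range (e + 1), rt K (k * i) (c i * x)

/-- Evaluation of the `𝔽_p`-linearised polynomial `∑_{i=1}^{e} c_i x^{p^i}`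
(no constant-in-`x` coefficient). -/
def LpolyIcc [Field K] (p e : ℕ) (c : ℕ → K) (x : K) : K :=
  ∑ i ∈ Finset.Icc 1 e, c i * x ^ p ^ i

/-- The adjoint `R^*(x) = ∑_{i=1}^{e} (c_i x)^{p^{-i}}` (with `p = 2^k`). -/
def adjIcc [Field K] [ExpChar K 2] [PerfectRing K 2] (k e : ℕ) (c : ℕ → K) (x : K) : K :=
  ∑ i ∈ Finset.Icc 1 e, rt K (k * i) (c i * x)

/-- The coefficients `a_i = ∑_{j=0}^{e-i} (b_j b_{j+i})^{p^{-j}}` of `R_F` (with `p = 2^k`). -/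
def aRF [Field K] [ExpChar K 2] [PerfectRing K 2] (k e : ℕ) (b : ℕ → K) (i : ℕ) : K :=
  ∑ j ∈ Finset.range (e - i + 1), rt K (k * j) (b j * b (j + i))

/-- The linearised polynomial `R_F(x) = ∑_{i=1}^{e} a_i x^{p^i}` (with `p = 2^k`). -/
def RF [Field K] [ExpChar K 2] [PerfectRing K 2] (k e : ℕ) (b : ℕ → K) (x : K) : K :=
  ∑ i ∈ Finset.Icc 1 e, aRF k e b i * x ^ (2 ^ k) ^ i

/-- `γ_F = ∑_{0 ≤ i < j ≤ e} b_i^{p^{-i}} b_j^{p^{-j}}` (with `p = 2^k`). -/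
def gammaF [Field K] [ExpChar K 2] [PerfectRing K 2] (k e : ℕ) (b : ℕ → K) : K :=
  ∑ i ∈ Finset.range (e + 1), ∑ j ∈ Finset.Ioo i (e + 1), rt K (k * i) (b i) * rt K (k * j) (b j)

/-- `α_F(t) = γ_F + F^*(t)²`. -/
def alphaF [Field K] [ExpChar K 2] [PerfectRing K 2] (k e : ℕ) (b : ℕ → K) (t : K) : K :=
  gammaF k e b + adj k e b t ^ 2

/-- `R_{F,t}(x) = R_F(x) + α_F(t) x`. -/
def RFt [Field K] [ExpChar K 2] [PerfectRing K 2] (k e : ℕ) (b : ℕ → K) (t x : K) : K :=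
  RF k e b x + alphaF k e b t * x

/-- The number of affine points of the van der Geer–van der Vlugt curve
`y^p - y = x R(x)` with coordinates in `K`. -/
def Ncount (K : Type*) [Field K] (p : ℕ) (R : K → K) : ℕ :=
  Nat.card {z : K × K // z.2 ^ p - z.2 = z.1 * R z.1}

/-- The adjoint `F^*` of `F(x) = ∑_{i=0}^{e} b_i x^{p^i}`, with coefficients `b_i ∈ K`,
viewed as a function on the algebraic closure `𝔽` of `K`. -/
def adjBar [Field K] [CharP K 2] (k e : ℕ) (b : ℕ → K) (x : AlgebraicClosure K) : AlgebraicClosure K :=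
  adj k e (fun i => algebraMap K (AlgebraicClosure K) (b i)) x

/-- `F(x) = ∑_{i=0}^{e} b_i x^{p^i}`, with coefficients `b_i ∈ K`, viewed as a function on
the algebraic closure `𝔽` of `K` (with `p = 2^k`). -/
def LpolyBar [Field K] [CharP K 2] (k e : ℕ) (b : ℕ → K) (x : AlgebraicClosure K) : AlgebraicClosure K :=
  Lpoly (2 ^ k) e (fun i => algebraMap K (AlgebraicClosure K) (b i)) x


theorem la_iso {k X : Type*} [Field k] [AddCommGroup X] [Module k X] [FiniteDimensional k X]
    (B : LinearMap.BilinForm k X) (hB : B.IsAlt) (f : X →ₗ[k] k) (e : ℕ)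
    (hdim : Module.finrank k X + Module.finrank k (B.orthogonal ⊤) = 2 * e)
    (hrad : B.orthogonal ⊤ ≤ LinearMap.ker f) :
    ∃ L : Submodule k X, L ≤ LinearMap.ker f ∧ (∀ u ∈ L, ∀ v ∈ L, B u v = 0) ∧
      Module.finrank k L = e := by
  have hrefl : B.IsRefl := hB.isRefl
  let S : Set (Submodule k X) :=
    {L | L ≤ LinearMap.ker f ∧ (∀ u ∈ L, ∀ v ∈ L, B u v = 0) ∧ B.orthogonal ⊤ ≤ L}
  have hne : B.orthogonal ⊤ ∈ S := by
    refine ⟨hrad, ?_, le_rfl⟩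
    intro u _ v hv
    exact (LinearMap.BilinForm.mem_orthogonal_iff.1 hv) u trivial
  obtain ⟨L, hLS, hmax⟩ : ∃ L ∈ S, ∀ L' ∈ S, Module.finrank k L' ≤ Module.finrank k L := by
    have hfin : (Set.image (fun L : Submodule k X => Module.finrank k L) S).Finite := by
      refine (Set.finite_le_nat (Module.finrank k X)).subset ?_
      rintro _ ⟨L, _, rfl⟩
      exact Submodule.finrank_le L
    obtain ⟨L, hL, h⟩ := Set.Finite.exists_maximalFor'
      (fun L : Submodule k X => Module.finrank k L) S hfin ⟨_, hne⟩
    refine ⟨L, hL, fun L' hL' => ?_⟩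
    rcases le_total (Module.finrank k L') (Module.finrank k L) with h1 | h1
    · exact h1
    · exact h hL' h1
  obtain ⟨hLf, hLi, hLr⟩ := hLS
  have hd := LinearMap.BilinForm.finrank_add_finrank_orthogonal hrefl L
  rw [inf_eq_right.2 hLr] at hd
  have hLperp : L ≤ B.orthogonal L := fun v hv =>
    LinearMap.BilinForm.mem_orthogonal_iff.2 fun n hn => hLi n hn v hv
  have hle := Submodule.finrank_mono hLperp
  -- maximality
  have hmx : B.orthogonal L ⊓ LinearMap.ker f ≤ L := by
    rintro x ⟨hx1, hx2⟩
    have hx1' := LinearMap.BilinForm.mem_orthogonal_iff.1 hx1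
    have hmem : L ⊔ Submodule.span k {x} ∈ S := by
      refine ⟨sup_le hLf ?_, ?_, le_trans hLr le_sup_left⟩
      · rw [Submodule.span_le]; rintro _ rfl; exact hx2
      · intro u hu v hv
        obtain ⟨u1, hu1, u2, hu2, rfl⟩ := Submodule.mem_sup.1 hu
        obtain ⟨v1, hv1, v2, hv2, rfl⟩ := Submodule.mem_sup.1 hv
        obtain ⟨c, rfl⟩ := Submodule.mem_span_singleton.1 hu2
        obtain ⟨d, rfl⟩ := Submodule.mem_span_singleton.1 hv2
        have h1 : B u1 x = 0 := hx1' u1 hu1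
        have h2 : B x v1 = 0 := hrefl _ _ (hx1' v1 hv1)
        have h3 : B x x = 0 := hB x
        simp [hLi u1 hu1 v1 hv1, h1, h2, h3]
    have h := hmax _ hmem
    have := Submodule.eq_of_le_of_finrank_le (le_sup_left : L ≤ L ⊔ Submodule.span k {x}) h
    rw [this]
    exact Submodule.mem_sup_right (Submodule.mem_span_singleton_self x)
  have hcod : Module.finrank k (B.orthogonal L) ≤
      Module.finrank k (B.orthogonal L ⊓ LinearMap.ker f : Submodule k X) + 1 := by
    have h1 := Submodule.finrank_sup_add_finrank_inf_eq (B.orthogonal L) (LinearMap.ker f)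
    have h2 := LinearMap.finrank_range_add_finrank_ker f
    have h3 : Module.finrank k (LinearMap.range f) ≤ 1 := by
      simpa using Submodule.finrank_le (LinearMap.range f)
    have h4 := Submodule.finrank_le (B.orthogonal L ⊔ LinearMap.ker f)
    omega
  have h5 := Submodule.finrank_mono hmx
  exact ⟨L, hLf, hLi, by omega⟩

theorem la_adj {k X : Type*} [Field k] [AddCommGroup X] [Module k X] [FiniteDimensional k X]
    (B : LinearMap.BilinForm k X) (hB : B.Nondegenerate) (hs : ∀ x y, B x y = B y x)
    (f g : X →ₗ[k] X) (hfg : ∀ x y, B (f x) y = B x (g y)) :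
    Module.finrank k (LinearMap.ker f) = Module.finrank k (LinearMap.ker g) ∧
    LinearMap.range g = B.orthogonal (LinearMap.ker f) := by
  have hrefl : B.IsRefl := fun x y h => by rw [hs]; exact h
  have key : ∀ f g : X →ₗ[k] X, (∀ x y, B (f x) y = B x (g y)) →
      LinearMap.ker g = B.orthogonal (LinearMap.range f) := by
    intro f g hfg
    ext y
    rw [LinearMap.mem_ker, LinearMap.BilinForm.mem_orthogonal_iff]
    constructor
    · rintro h _ ⟨x, rfl⟩
      show B (f x) y = 0
      rw [hfg, h, map_zero]
    · intro h
      refine hB.2 _ fun x => ?_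
      rw [← hfg]; exact h _ ⟨x, rfl⟩
  have h1 := key f g hfg
  have h2 := key g f (fun x y => by rw [hs, ← hfg, hs])
  constructor
  · rw [h1, LinearMap.BilinForm.finrank_orthogonal hB, ← LinearMap.finrank_range_add_finrank_ker f]
    omega
  · rw [h2, LinearMap.BilinForm.orthogonal_orthogonal hB hrefl]

section ops

variable {A : Type*} [Field A] (φ : RingAut A)

/-- integer powers of `φ` as ring homs -/
def ph (n : ℤ) : A →+* A := ((φ ^ n : RingAut A) : A ≃+* A).toRingHom

theorem ph_add (m n : ℤ) (x : A) : ph φ (m + n) x = ph φ m (ph φ n x) := by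
  show (φ ^ (m + n) : RingAut A) x = (φ ^ m : RingAut A) ((φ ^ n : RingAut A) x)
  rw [zpow_add]; rfl

theorem ph_zero (x : A) : ph φ 0 x = x := by
  show (φ ^ (0:ℤ) : RingAut A) x = x
  rw [zpow_zero]; rfl

theorem ph_one (x : A) : ph φ 1 x = φ x := by
  show (φ ^ (1:ℤ) : RingAut A) x = φ x
  rw [zpow_one]

theorem ph_comm (m n : ℤ) (x : A) : ph φ m (ph φ n x) = ph φ n (ph φ m x) := by
  rw [← ph_add, ← ph_add, add_comm]

theorem ph_neg_cancel (n : ℤ) (x : A) : ph φ (-n) (ph φ n x) = x := by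
  rw [← ph_add, neg_add_cancel, ph_zero]

theorem ph_cancel_neg (n : ℤ) (x : A) : ph φ n (ph φ (-n) x) = x := by
  rw [← ph_add, add_neg_cancel, ph_zero]

/-- the fixed field of `φ` -/
def k0 : Subfield A := RingHom.eqLocusField (ph φ 1) (RingHom.id A)

theorem mem_k0 {x : A} : x ∈ k0 φ ↔ ph φ 1 x = x := Iff.rfl

theorem ph_k0 {x : A} (hx : x ∈ k0 φ) (n : ℤ) : ph φ n x = x := by
  have h : φ ∈ MulAction.stabilizer (RingAut A) x := by
    rw [MulAction.mem_stabilizer_iff]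
    have := (mem_k0 φ).1 hx
    rwa [ph_one] at this
  exact MulAction.mem_stabilizer_iff.1 ((MulAction.stabilizer (RingAut A) x).zpow_mem h n)

/-- `ph` as linear map -/
def phL (n : ℤ) : A →ₗ[k0 φ] A where
  toFun x := ph φ n x
  map_add' := map_add _
  map_smul' c x := by
    show ph φ n ((c : A) * x) = (c : A) * ph φ n x
    rw [map_mul, ph_k0 φ c.2]

theorem phL_apply (n : ℤ) (x : A) : phL φ n x = ph φ n x := rfl

/-- multiplication as linear map -/
def muL (c : A) : A →ₗ[k0 φ] A := LinearMap.mulLeft (k0 φ) c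

theorem muL_apply (c x : A) : muL φ c x = c * x := rfl

/-- `∑ c_i φ^i` -/
def PL (d : ℕ) (c : ℕ → A) : A →ₗ[k0 φ] A :=
  ∑ i ∈ Finset.range (d + 1), muL φ (c i) ∘ₗ phL φ i

theorem PL_apply (d : ℕ) (c : ℕ → A) (x : A) :
    PL φ d c x = ∑ i ∈ Finset.range (d + 1), c i * ph φ i x := by
  simp [PL, LinearMap.sum_apply, muL_apply, phL_apply]

/-- `∑ φ^{-i} c_i` -/
def PS (d : ℕ) (c : ℕ → A) : A →ₗ[k0 φ] A :=
  ∑ i ∈ Finset.range (d + 1), phL φ (-i) ∘ₗ muL φ (c i)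

theorem PS_apply (d : ℕ) (c : ℕ → A) (x : A) :
    PS φ d c x = ∑ i ∈ Finset.range (d + 1), ph φ (-i) (c i * x) := by
  simp [PS, LinearMap.sum_apply, muL_apply, phL_apply]

/-- trace -/
def TT (n : ℕ) : A →ₗ[k0 φ] A := ∑ i ∈ Finset.range n, phL φ i

theorem TT_apply (n : ℕ) (x : A) : TT φ n x = ∑ i ∈ Finset.range n, ph φ i x := by
  simp [TT, LinearMap.sum_apply, phL_apply]

/-- self-adjoint operators, without the constant term -/
def DD (e : ℕ) (s : ℕ → A) : A →ₗ[k0 φ] A :=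
  ∑ i ∈ Finset.range e, (muL φ (s (i+1)) ∘ₗ phL φ (i+1) + phL φ (-(i+1)) ∘ₗ muL φ (s (i+1)))

theorem DD_apply (e : ℕ) (s : ℕ → A) (x : A) : DD φ e s x = ∑ i ∈ Finset.range e,
    (s (i+1) * ph φ (i+1) x + ph φ (-(i+1)) (s (i+1) * x)) := by
  simp only [DD, LinearMap.sum_apply]
  rfl

/-- fixed space of `φ^n` -/
def Fx (n : ℕ) : Submodule (k0 φ) A := LinearMap.ker (phL φ n - LinearMap.id)

theorem mem_Fx {n : ℕ} {x : A} : x ∈ Fx φ n ↔ ph φ n x = x := by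
  simp [Fx, phL_apply, sub_eq_zero]

theorem ph_mem_Fx {n : ℕ} {x : A} (hx : x ∈ Fx φ n) (j : ℤ) : ph φ j x ∈ Fx φ n := by
  rw [mem_Fx] at *
  rw [ph_comm, hx]

theorem mul_mem_Fx {n : ℕ} {x y : A} (hx : x ∈ Fx φ n) (hy : y ∈ Fx φ n) : x * y ∈ Fx φ n := by
  rw [mem_Fx] at *
  rw [map_mul, hx, hy]

theorem TT_comm (n : ℕ) (j : ℤ) (x : A) : TT φ n (ph φ j x) = ph φ j (TT φ n x) := by
  rw [TT_apply, TT_apply, map_sum]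
  exact Finset.sum_congr rfl fun i _ => ph_comm φ _ _ _

theorem TT_mem (n : ℕ) {x : A} (hx : x ∈ Fx φ n) : TT φ n x ∈ k0 φ := by
  rw [mem_k0, ← TT_comm, TT_apply, TT_apply]
  have h1 := Finset.sum_range_succ (fun i : ℕ => ph φ i x) n
  have h2 := Finset.sum_range_succ' (fun i : ℕ => ph φ i x) n
  rw [h1] at h2
  rw [(mem_Fx φ).1 hx] at h2
  simp only [Nat.cast_zero, ph_zero] at h2
  have h3 := add_right_cancel h2
  rw [h3]
  refine Finset.sum_congr rfl fun i _ => ?_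
  rw [← ph_add]; push_cast; rfl

theorem TT_ph (n : ℕ) {x : A} (hx : x ∈ Fx φ n) (j : ℤ) : TT φ n (ph φ j x) = TT φ n x := by
  rw [TT_comm, ph_k0 φ (TT_mem φ n hx)]

theorem PL_mem {n d : ℕ} {c : ℕ → A} (hc : ∀ i, c i ∈ Fx φ n) {x : A} (hx : x ∈ Fx φ n) :
    PL φ d c x ∈ Fx φ n := by
  rw [PL_apply]
  exact Submodule.sum_mem _ fun i _ => mul_mem_Fx φ (hc i) (ph_mem_Fx φ hx _)

theorem PS_mem {n d : ℕ} {c : ℕ → A} (hc : ∀ i, c i ∈ Fx φ n) {x : A} (hx : x ∈ Fx φ n) :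
    PS φ d c x ∈ Fx φ n := by
  rw [PS_apply]
  exact Submodule.sum_mem _ fun i _ => ph_mem_Fx φ (mul_mem_Fx φ (hc i) hx) _

theorem PL_adj {n d : ℕ} {c : ℕ → A} (hc : ∀ i, c i ∈ Fx φ n) {x y : A} (hx : x ∈ Fx φ n)
    (hy : y ∈ Fx φ n) : TT φ n (PL φ d c x * y) = TT φ n (x * PS φ d c y) := by
  rw [PL_apply, PS_apply, Finset.sum_mul, Finset.mul_sum, map_sum, map_sum]
  refine Finset.sum_congr rfl fun i _ => ?_
  rw [← TT_ph φ n (x := x * _) (mul_mem_Fx φ hx (ph_mem_Fx φ (mul_mem_Fx φ (hc i) hy) _)) i]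
  rw [map_mul (ph φ _), ph_cancel_neg]
  congr 1; ring

/-- commutation with `φ^n` for coefficients in the fixed field -/
theorem PL_ph {n d : ℕ} {c : ℕ → A} (hc : ∀ i, c i ∈ Fx φ n) (x : A) :
    PL φ d c (ph φ n x) = ph φ n (PL φ d c x) := by
  rw [PL_apply, PL_apply, map_sum]
  refine Finset.sum_congr rfl fun i _ => ?_
  rw [map_mul, (mem_Fx φ).1 (hc i), ph_comm]

theorem PS_ph {n d : ℕ} {c : ℕ → A} (hc : ∀ i, c i ∈ Fx φ n) (x : A) :
    PS φ d c (ph φ n x) = ph φ n (PS φ d c x) := by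
  rw [PS_apply, PS_apply, map_sum]
  refine Finset.sum_congr rfl fun i _ => ?_
  rw [ph_comm φ n, map_mul (ph φ n), (mem_Fx φ).1 (hc i)]

theorem DD_ph {n e : ℕ} {s : ℕ → A} (hc : ∀ i, s i ∈ Fx φ n) (x : A) :
    DD φ e s (ph φ n x) = ph φ n (DD φ e s x) := by
  rw [DD_apply, DD_apply, map_sum]
  refine Finset.sum_congr rfl fun i _ => ?_
  rw [map_add, map_mul (ph φ n), (mem_Fx φ).1 (hc _), ph_comm φ n (i+1), ph_comm φ n (-(i+1)),
    map_mul (ph φ n), (mem_Fx φ).1 (hc _)]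

theorem DD_mem {n e : ℕ} {s : ℕ → A} (hc : ∀ i, s i ∈ Fx φ n) {x : A} (hx : x ∈ Fx φ n) :
    DD φ e s x ∈ Fx φ n := by
  rw [mem_Fx, ← DD_ph φ hc, (mem_Fx φ).1 hx]

theorem DD_adj {n e : ℕ} {s : ℕ → A} (hc : ∀ i, s i ∈ Fx φ n) {x y : A} (hx : x ∈ Fx φ n)
    (hy : y ∈ Fx φ n) : TT φ n (DD φ e s x * y) = TT φ n (x * DD φ e s y) := by
  rw [DD_apply, DD_apply, Finset.sum_mul, Finset.mul_sum, map_sum, map_sum]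
  refine Finset.sum_congr rfl fun i _ => ?_
  rw [add_mul, mul_add, map_add, map_add, add_comm]
  congr 1
  · rw [← TT_ph φ n (x := _ * y) (mul_mem_Fx φ (ph_mem_Fx φ (mul_mem_Fx φ (hc _) hx) _) hy) (i+1)]
    rw [map_mul (ph φ _), ph_cancel_neg]
    congr 1; ring
  · rw [← TT_ph φ n (x := x * _) (mul_mem_Fx φ hx (ph_mem_Fx φ (mul_mem_Fx φ (hc _) hy) _)) (i+1)]
    rw [map_mul (ph φ _), ph_cancel_neg]
    congr 1; ring

/-- the constant-coefficient split of `R + R*` -/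
theorem R_eq_DD [CharP A 2] (e : ℕ) (s : ℕ → A) (x : A) :
    PL φ e s x + PS φ e s x = DD φ e s x := by
  rw [PL_apply, PS_apply, DD_apply, Finset.sum_range_succ', Finset.sum_range_succ' _ e,
    Finset.sum_add_distrib]
  simp only [Nat.cast_zero, neg_zero, ph_zero, Nat.cast_add, Nat.cast_one]
  have := CharTwo.add_self_eq_zero (s 0 * x)
  linear_combination this

end ops

section roots

/-- the linearised polynomial -/
def lpol {A : Type*} [Field A] (k d : ℕ) (c : ℕ → A) : Polynomial A :=
  ∑ i ∈ Finset.range (d + 1), Polynomial.C (c i) * Polynomial.X ^ (2 ^ k) ^ i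

variable {A : Type*} [Field A] (φ : RingAut A) {k : ℕ}

theorem ph_nat (hφ : ∀ x, ph φ 1 x = x ^ 2 ^ k) (i : ℕ) (x : A) :
    ph φ i x = x ^ (2 ^ k) ^ i := by
  induction i with
  | zero => simp [ph_zero]
  | succ n ih => rw [Nat.cast_succ, add_comm, ph_add, hφ, ih, ← pow_mul, pow_succ]

theorem lpol_eval (hφ : ∀ x, ph φ 1 x = x ^ 2 ^ k) (d : ℕ) (c : ℕ → A) (x : A) :
    (lpol k d c).eval x = PL φ d c x := by
  rw [lpol, PL_apply, Polynomial.eval_finsetSum]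
  refine Finset.sum_congr rfl fun i _ => ?_
  simp [ph_nat φ hφ]

theorem lpol_coeff (hk : 1 ≤ k) (d : ℕ) (c : ℕ → A) (j : ℕ) (hj : j ≤ d) :
    (lpol k d c).coeff ((2 ^ k) ^ j) = c j := by
  rw [lpol, Polynomial.finsetSum_coeff, Finset.sum_eq_single j]
  · simp
  · intro b _ hb
    rw [Polynomial.coeff_C_mul, Polynomial.coeff_X_pow, if_neg, mul_zero]
    intro h
    exact hb (Nat.pow_right_injective (Nat.one_lt_two_pow (by omega)) h).symm
  · intro h; simp at h; omega

theorem lpol_natDegree_le (d : ℕ) (c : ℕ → A) : (lpol k d c).natDegree ≤ (2 ^ k) ^ d := by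
  refine Polynomial.natDegree_sum_le_of_forall_le _ _ fun i hi => ?_
  refine (Polynomial.natDegree_C_mul_X_pow_le _ _).trans ?_
  simp at hi
  exact Nat.pow_le_pow_right (by positivity) (by omega)

theorem ker_fin (hφ : ∀ x, ph φ 1 x = x ^ 2 ^ k) (hk : 1 ≤ k) (d : ℕ) (c : ℕ → A)
    (hc : ∃ i ≤ d, c i ≠ 0) : {x | PL φ d c x = 0}.Finite ∧
      {x | PL φ d c x = 0}.ncard ≤ (2 ^ k) ^ d := by
  obtain ⟨i, hi, hci⟩ := hc
  have hne : lpol k d c ≠ 0 := by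
    intro h
    have := lpol_coeff hk d c i hi
    rw [h] at this; simp at this; exact hci this.symm
  have hset : {x | PL φ d c x = 0} = ((lpol k d c).roots.toFinset : Set A) := by
    ext x
    simp [hne, lpol_eval φ hφ]
  rw [hset]
  refine ⟨Finset.finite_toSet _, ?_⟩
  rw [Set.ncard_coe_finset]
  exact (Multiset.toFinset_card_le _).trans ((Polynomial.card_roots' _).trans (lpol_natDegree_le d c))

theorem isCoprime_unit_right {R : Type*} [CommRing R] {a b : R} (h : IsUnit b) :
    IsCoprime a b := by
  obtain ⟨u, rfl⟩ := h
  exact ⟨0, ↑u⁻¹, by simp⟩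

theorem ker_card [IsAlgClosed A] [CharP A 2] (hφ : ∀ x, ph φ 1 x = x ^ 2 ^ k) (hk : 1 ≤ k)
    (d : ℕ) (c : ℕ → A) (h0 : c 0 ≠ 0) (hd : c d ≠ 0) :
    {x | PL φ d c x = 0}.ncard = (2 ^ k) ^ d := by
  have hco := lpol_coeff hk d c d le_rfl
  have hne : lpol k d c ≠ 0 := by
    intro h
    rw [h] at hco; simp at hco; exact hd hco.symm
  have hset : {x | PL φ d c x = 0} = ((lpol k d c).roots.toFinset : Set A) := by
    ext x
    simp [hne, lpol_eval φ hφ]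
  have hdeg : (lpol k d c).natDegree = (2 ^ k) ^ d := by
    refine le_antisymm (lpol_natDegree_le d c) ?_
    apply Polynomial.le_natDegree_of_ne_zero
    rw [hco]; exact hd
  have hder : Polynomial.derivative (lpol k d c) = Polynomial.C (c 0) := by
    rw [lpol, Polynomial.derivative_sum, Finset.sum_range_succ', Finset.sum_eq_zero]
    · simp
    · intro i _
      rw [Polynomial.derivative_C_mul_X_pow]
      have : (((2 ^ k) ^ (i + 1) : ℕ) : A) = 0 := by
        rw [CharP.cast_eq_zero_iff A 2, ← pow_mul]
        exact dvd_pow_self 2 (by positivity)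
      rw [this]; simp
  have hsep : (lpol k d c).Separable := by
    rw [Polynomial.separable_def, hder]
    exact isCoprime_unit_right ((Polynomial.isUnit_C).2 (isUnit_iff_ne_zero.2 h0))
  rw [hset, Set.ncard_coe_finset, Multiset.toFinset_card_of_nodup (Polynomial.nodup_roots hsep),
    ← (IsAlgClosed.splits _).natDegree_eq_card_roots, hdeg]

theorem Fx_eq [CharP A 2] {n : ℕ} (hn : 1 ≤ n) :
    Fx φ n = LinearMap.ker (PL φ n (fun i => if i = 0 ∨ i = n then 1 else 0)) := by
  obtain ⟨n, rfl⟩ : ∃ j, n = j + 1 := ⟨n - 1, by omega⟩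
  ext x
  rw [mem_Fx, LinearMap.mem_ker, PL_apply, Finset.sum_range_succ, Finset.sum_range_succ',
    Finset.sum_eq_zero]
  · simp only [Nat.cast_zero, ph_zero]
    simp only [true_or, or_true, if_true, one_mul, zero_add]
    rw [CharTwo.add_eq_zero, eq_comm]
  · intro i hi
    simp at hi
    simp; intro h; omega

theorem k0_eq : ((k0 φ : Subfield A) : Set A) = Fx φ 1 := by
  ext x
  simp only [SetLike.mem_coe, mem_k0, mem_Fx, Nat.cast_one]

variable [IsAlgClosed A] [CharP A 2]

theorem k0_card (hφ : ∀ x, ph φ 1 x = x ^ 2 ^ k) (hk : 1 ≤ k) : Nat.card (k0 φ) = 2 ^ k := by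
  have h := ker_card φ hφ hk 1 (fun i => if i = 0 ∨ i = 1 then 1 else 0) (by simp) (by simp)
  have h2 := k0_eq φ
  rw [Fx_eq φ le_rfl] at h2
  rw [pow_one] at h
  rw [← h]
  show Nat.card ((k0 φ : Subfield A) : Set A) = _
  rw [h2]; rfl

theorem k0_fin (hφ : ∀ x, ph φ 1 x = x ^ 2 ^ k) (hk : 1 ≤ k) : Finite (k0 φ) := by
  apply Nat.finite_of_card_ne_zero
  rw [k0_card φ hφ hk]; positivity

theorem card_fr (hφ : ∀ x, ph φ 1 x = x ^ 2 ^ k) (hk : 1 ≤ k) (S : Submodule (k0 φ) A)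
    (hS : (S : Set A).Finite) : (S : Set A).ncard = (2 ^ k) ^ Module.finrank (k0 φ) S := by
  haveI := k0_fin φ hφ hk
  haveI : Finite S := hS
  letI := Fintype.ofFinite (k0 φ)
  letI := Fintype.ofFinite S
  have := Module.card_eq_pow_finrank (K := k0 φ) (V := S)
  rw [← Nat.card_eq_fintype_card, ← Nat.card_eq_fintype_card, k0_card φ hφ hk] at this
  exact this

theorem fd_of_fin (S : Submodule (k0 φ) A)
    (hS : (S : Set A).Finite) : FiniteDimensional (k0 φ) S := by
  haveI : Finite S := hS
  exact Module.Finite.of_finite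

theorem PL_fin (hφ : ∀ x, ph φ 1 x = x ^ 2 ^ k) (hk : 1 ≤ k) (d : ℕ) (c : ℕ → A)
    (hc : ∃ i ≤ d, c i ≠ 0) : (LinearMap.ker (PL φ d c) : Set A).Finite :=
  (ker_fin φ hφ hk d c hc).1

theorem PL_le (hφ : ∀ x, ph φ 1 x = x ^ 2 ^ k) (hk : 1 ≤ k) (d : ℕ) (c : ℕ → A)
    (hc : ∃ i ≤ d, c i ≠ 0) : Module.finrank (k0 φ) (LinearMap.ker (PL φ d c)) ≤ d := by
  have h := (ker_fin φ hφ hk d c hc).2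
  have h2 := card_fr φ hφ hk _ (PL_fin φ hφ hk d c hc)
  have h3 : (2 ^ k) ^ Module.finrank (k0 φ) (LinearMap.ker (PL φ d c)) ≤ (2 ^ k) ^ d := by
    rw [← h2]; exact h
  exact (Nat.pow_le_pow_iff_right (Nat.one_lt_two_pow (by omega))).1 h3

theorem PL_fr (hφ : ∀ x, ph φ 1 x = x ^ 2 ^ k) (hk : 1 ≤ k) (d : ℕ) (c : ℕ → A)
    (h0 : c 0 ≠ 0) (hd : c d ≠ 0) : Module.finrank (k0 φ) (LinearMap.ker (PL φ d c)) = d := by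
  have h := ker_card φ hφ hk d c h0 hd
  have h2 := card_fr φ hφ hk _ (PL_fin φ hφ hk d c ⟨0, by omega, h0⟩)
  have h3 : (2 ^ k) ^ Module.finrank (k0 φ) (LinearMap.ker (PL φ d c)) = (2 ^ k) ^ d := by
    rw [← h2]; exact h
  exact (Nat.pow_right_injective (Nat.one_lt_two_pow (by omega))) h3

theorem Fx_fin (hφ : ∀ x, ph φ 1 x = x ^ 2 ^ k) (hk : 1 ≤ k) {n : ℕ} (hn : 1 ≤ n) :
    (Fx φ n : Set A).Finite := by
  rw [Fx_eq φ hn]; exact PL_fin φ hφ hk _ _ ⟨0, by omega, by simp⟩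

theorem Fx_fr (hφ : ∀ x, ph φ 1 x = x ^ 2 ^ k) (hk : 1 ≤ k) {n : ℕ} (hn : 1 ≤ n) :
    Module.finrank (k0 φ) (Fx φ n) = n := by
  rw [Fx_eq φ hn]; exact PL_fr φ hφ hk _ _ (by simp) (by simp)

/-- coefficients of `φ^e ∘ F*` -/
theorem PS_shift (e : ℕ) (c : ℕ → A) (x : A) :
    ph φ e (PS φ e c x) = PL φ e (fun j => ph φ j (c (e - j))) x := by
  rw [PS_apply, PL_apply, map_sum, ← Finset.sum_range_reflect]
  refine Finset.sum_congr rfl fun i hi => ?_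
  simp at hi
  have h1 : e + 1 - 1 - i = e - i := by omega
  rw [h1, ← map_mul, ← ph_add]
  congr 1
  rw [Nat.cast_sub (by omega)]; ring_nf

theorem PS_ker (e : ℕ) (c : ℕ → A) :
    LinearMap.ker (PS φ e c) = LinearMap.ker (PL φ e (fun j => ph φ j (c (e - j)))) := by
  ext x
  rw [LinearMap.mem_ker, LinearMap.mem_ker, ← PS_shift, map_eq_zero (ph φ _)]

/-- coefficients of `φ^e ∘ (DD + γ)` -/
def dcoef (e : ℕ) (s : ℕ → A) (γ : A) (j : ℕ) : A :=
  if j < e then ph φ j (s (e - j)) else if j = e then ph φ e γ else ph φ e (s (j - e))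

theorem DD_shift (e : ℕ) (s : ℕ → A) (γ : A) (x : A) :
    ph φ e (DD φ e s x + γ * x) = PL φ (2 * e) (dcoef φ e s γ) x := by
  rw [PL_apply, show 2 * e + 1 = e + (1 + e) by ring, Finset.sum_range_add, Finset.sum_range_add,
    DD_apply, map_add, map_sum, Finset.sum_range_one, ← Finset.sum_range_reflect _ e]
  have h1 : ∑ i ∈ Finset.range e, ph φ e
      (s (i+1) * ph φ (i+1) x + ph φ (-(i+1)) (s (i+1) * x)) =
      ∑ i ∈ Finset.range e, ph φ e (s (i+1) * ph φ (i+1) x) +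
      ∑ i ∈ Finset.range e, ph φ e (ph φ (-(i+1)) (s (i+1) * x)) := by
    rw [← Finset.sum_add_distrib]
    exact Finset.sum_congr rfl fun i _ => map_add _ _ _
  have h0 : ∑ j ∈ Finset.range e, ph φ e (s (e - 1 - j + 1) * ph φ ((e - 1 - j : ℕ) + 1) x +
      ph φ (-((e - 1 - j : ℕ)+1)) (s (e - 1 - j +1) * x)) = ∑ i ∈ Finset.range e, ph φ e
      (s (i+1) * ph φ (i+1) x + ph φ (-(i+1)) (s (i+1) * x)) :=
    Finset.sum_range_reflect (fun i : ℕ => ph φ e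
      (s (i+1) * ph φ (i+1) x + ph φ (-(i+1)) (s (i+1) * x))) e
  rw [h0, h1]
  have h2 : ∑ i ∈ Finset.range e, ph φ e (s (i+1) * ph φ (i+1) x) =
      ∑ i ∈ Finset.range e, dcoef φ e s γ (e + (1 + i)) * ph φ ((e + (1 + i) : ℕ)) x := by
    refine Finset.sum_congr rfl fun i _ => ?_
    rw [dcoef, if_neg (by omega), if_neg (by omega), show e + (1 + i) - e = i + 1 by omega,
      map_mul, ← ph_add]
    congr 3; push_cast; ring
  have h3 : ∑ i ∈ Finset.range e, ph φ e (ph φ (-(i+1)) (s (i+1) * x)) =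
      ∑ i ∈ Finset.range e, dcoef φ e s γ i * ph φ i x := by
    rw [← Finset.sum_range_reflect]
    refine Finset.sum_congr rfl fun i hi => ?_
    simp at hi
    rw [dcoef, if_pos (by omega), show e - 1 - i + 1 = e - i by omega, ← ph_add, map_mul]
    have : (e : ℤ) + -(((e - 1 - i : ℕ) : ℤ) + 1) = i := by omega
    rw [this]
  have h4 : ph φ e (γ * x) = dcoef φ e s γ (e + 0) * ph φ ((e + 0 : ℕ)) x := by
    rw [dcoef, if_neg (by omega), if_pos (by omega), map_mul, add_zero]
  rw [h2, h3, h4]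
  ring

theorem DD_ker (e : ℕ) (s : ℕ → A) (γ : A) :
    LinearMap.ker (DD φ e s + muL φ γ) = LinearMap.ker (PL φ (2 * e) (dcoef φ e s γ)) := by
  ext x
  rw [LinearMap.mem_ker, LinearMap.mem_ker, ← DD_shift, map_eq_zero (ph φ _), LinearMap.add_apply,
    muL_apply]

theorem DD_fin (hφ : ∀ x, ph φ 1 x = x ^ 2 ^ k) (hk : 1 ≤ k) (e : ℕ) (he : 1 ≤ e) (s : ℕ → A)
    (hs : s e ≠ 0) : (LinearMap.ker (DD φ e s) : Set A).Finite := by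
  have h := DD_ker φ e s 0
  have h0 : muL φ (0 : A) = 0 := by ext x; simp [muL_apply]
  rw [h0, add_zero] at h
  rw [h]
  refine PL_fin φ hφ hk _ _ ⟨0, by omega, ?_⟩
  rw [dcoef, if_pos (by omega)]; simpa using hs

theorem DD_fr (hφ : ∀ x, ph φ 1 x = x ^ 2 ^ k) (hk : 1 ≤ k) (e : ℕ) (he : 1 ≤ e) (s : ℕ → A)
    (hs : s e ≠ 0) : Module.finrank (k0 φ) (LinearMap.ker (DD φ e s)) = 2 * e := by
  have h := DD_ker φ e s 0
  have h0 : muL φ (0 : A) = 0 := by ext x; simp [muL_apply]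
  rw [h0, add_zero] at h
  rw [h]
  refine PL_fr φ hφ hk _ _ ?_ ?_
  · rw [dcoef, if_pos (by omega)]; simpa using hs
  · rw [dcoef, if_neg (by omega), if_neg (by omega), show 2 * e - e = e by omega]; simpa using hs

/-- a large kernel forces the coefficients to vanish -/
theorem DD_zero (hφ : ∀ x, ph φ 1 x = x ^ 2 ^ k) (hk : 1 ≤ k) (e : ℕ) (he : 1 ≤ e) (s : ℕ → A)
    (γ : A) (hs : s e = 0)
    (S : Submodule (k0 φ) A) (hS : ∀ x ∈ S, DD φ e s x + γ * x = 0)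
    (hfr : 2 * e ≤ Module.finrank (k0 φ) S) : (∀ i, 1 ≤ i → i ≤ e → s i = 0) ∧ γ = 0 := by
  obtain ⟨e, rfl⟩ : ∃ j, e = j + 1 := ⟨e - 1, by omega⟩
  have hD : ∀ x, DD φ (e + 1) s x = DD φ e s x := by
    intro x
    rw [DD_apply, DD_apply, Finset.sum_range_succ, hs]
    simp
  have hz : ∀ i ≤ 2 * e, dcoef φ e s γ i = 0 := by
    by_contra hcon
    push Not at hcon
    have h1 := PL_le φ hφ hk (2 * e) _ hcon
    haveI := fd_of_fin φ _ (PL_fin φ hφ hk (2 * e) _ hcon)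
    have h2 : S ≤ LinearMap.ker (PL φ (2 * e) (dcoef φ e s γ)) := by
      intro x hx
      rw [← DD_ker, LinearMap.mem_ker, LinearMap.add_apply, muL_apply, ← hD]
      exact hS x hx
    have h3 := Submodule.finrank_mono h2
    omega
  constructor
  · intro i hi hi2
    rcases Nat.lt_or_ge e i with h | h
    · rwa [show i = e + 1 by omega]
    · have := hz (e + i) (by omega)
      rw [dcoef, if_neg (by omega), if_neg (by omega), show e + i - e = i by omega,
        map_eq_zero (ph φ _)] at this
      exact this
  · have := hz e (by omega)
    rw [dcoef, if_neg (by omega), if_pos rfl, map_eq_zero (ph φ _)] at this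
    exact this

end roots

section combi

/-- sum over pairs `i < j ≤ e` -/
def S2 {A : Type*} [AddCommMonoid A] (e : ℕ) (f : ℕ → ℕ → A) : A :=
  ∑ r ∈ Finset.range e, ∑ i ∈ Finset.range (e - r), f i (i + r + 1)

theorem S2_succ {A : Type*} [AddCommMonoid A] (e : ℕ) (f : ℕ → ℕ → A) :
    S2 (e + 1) f = S2 e f + ∑ i ∈ Finset.range (e + 1), f i (e + 1) := by
  have h1 : S2 (e + 1) f = ∑ r ∈ Finset.range (e + 1),
      (∑ i ∈ Finset.range (e - r), f i (i + r + 1) + f (e - r) (e + 1)) := by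
    refine Finset.sum_congr rfl fun r hr => ?_
    simp at hr
    rw [show e + 1 - r = (e - r) + 1 by omega, Finset.sum_range_succ,
      show e - r + r + 1 = e + 1 by omega]
  rw [h1, Finset.sum_add_distrib, Finset.sum_range_succ]
  have h2 := Finset.sum_range_reflect (fun i => f i (e + 1)) (e + 1)
  simp only [Nat.add_sub_cancel] at h2
  rw [h2]
  simp [S2]

theorem S2_eq {A : Type*} [AddCommMonoid A] (e : ℕ) (f : ℕ → ℕ → A) :
    S2 e f = ∑ j ∈ Finset.range (e + 1), ∑ i ∈ Finset.range j, f i j := by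
  induction e with
  | zero => simp [S2]
  | succ n ih => rw [S2_succ, ih, Finset.sum_range_succ _ (n + 1)]

theorem S2_Ioo {A : Type*} [AddCommMonoid A] (e : ℕ) (f : ℕ → ℕ → A) :
    S2 e f = ∑ i ∈ Finset.range (e + 1), ∑ j ∈ Finset.Ioo i (e + 1), f i j := by
  rw [S2_eq]
  apply Finset.sum_comm'
  intro x y
  simp only [Finset.mem_range, Finset.mem_Ioo]
  omega

theorem sum_split {A : Type*} [AddCommMonoid A] (e : ℕ) (f : ℕ → ℕ → A) :
    ∑ i ∈ Finset.range (e + 1), ∑ j ∈ Finset.range (e + 1), f i j =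
      ∑ i ∈ Finset.range (e + 1), f i i + S2 e (fun i j => f i j + f j i) := by
  induction e with
  | zero => simp [S2]
  | succ n ih =>
    rw [S2_succ, Finset.sum_range_succ, Finset.sum_range_succ _ (n + 1)]
    simp_rw [Finset.sum_range_succ _ (n + 1)]
    rw [Finset.sum_add_distrib, ih, Finset.sum_add_distrib]
    abel

theorem S2_congr {A : Type*} [AddCommMonoid A] (e : ℕ) (f g : ℕ → ℕ → A)
    (h : ∀ r i, f i (i + r + 1) = g i (i + r + 1)) : S2 e f = S2 e g :=
  Finset.sum_congr rfl fun r _ => Finset.sum_congr rfl fun i _ => h r i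

end combi

section pairing

variable {A : Type*} [Field A] (φ : RingAut A) {k : ℕ}

/-- coefficients of `F*F` -/
def aR (e : ℕ) (b : ℕ → A) (r : ℕ) : A :=
  ∑ j ∈ Finset.range (e - r + 1), ph φ (-j) (b j * b (j + r))

theorem aR_mem {n e : ℕ} {b : ℕ → A} (hb : ∀ i, b i ∈ Fx φ n) (r : ℕ) : aR φ e b r ∈ Fx φ n :=
  Submodule.sum_mem _ fun j _ => ph_mem_Fx φ (mul_mem_Fx φ (hb j) (hb _)) _

theorem FF_eq [CharP A 2] (e : ℕ) (b : ℕ → A) (x : A) :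
    PS φ e b (PL φ e b x) = DD φ e (aR φ e b) x + (PS φ e b 1) ^ 2 * x := by
  have h1 : PS φ e b (PL φ e b x) = ∑ i ∈ Finset.range (e + 1), ∑ j ∈ Finset.range (e + 1),
      ph φ (-i) (b i * b j) * ph φ (j - i) x := by
    rw [PS_apply]
    refine Finset.sum_congr rfl fun i _ => ?_
    rw [PL_apply, Finset.mul_sum, map_sum]
    refine Finset.sum_congr rfl fun j _ => ?_
    rw [← mul_assoc, map_mul (ph φ _) (b i * b j), ← ph_add, neg_add_eq_sub]
  rw [h1, sum_split, add_comm]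
  congr 1
  · rw [DD_apply, S2]
    refine Finset.sum_congr rfl fun r hr => ?_
    simp at hr
    rw [aR, show e - (r + 1) + 1 = e - r by omega, Finset.sum_mul, Finset.sum_mul, map_sum,
      ← Finset.sum_add_distrib]
    refine Finset.sum_congr rfl fun i _ => ?_
    congr 1
    · congr 2
      push_cast; ring_nf
    · rw [map_mul (ph φ (-(r+1))), ← ph_add]
      push_cast
      ring_nf
  · rw [PS_apply, CharTwo.sum_sq, Finset.sum_mul]
    refine Finset.sum_congr rfl fun i _ => ?_
    rw [sub_self, ph_zero, mul_one, ← map_pow, sq]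

/-- quadratic trace -/
def QT (n : ℕ) (x : A) : A := ∑ s ∈ Finset.range n, ph φ s x * TT φ s x

theorem TT_succ (n : ℕ) (x : A) : TT φ (n + 1) x = TT φ n x + ph φ n x := by
  rw [TT_apply, TT_apply, Finset.sum_range_succ]

theorem TT_succ' (n : ℕ) (x : A) : TT φ (n + 1) x = TT φ n (ph φ 1 x) + x := by
  rw [TT_apply, TT_apply, Finset.sum_range_succ']
  simp only [Nat.cast_zero, ph_zero, Nat.cast_add, Nat.cast_one, ph_add]

theorem QT_succ (n : ℕ) (x : A) : QT φ (n + 1) x = QT φ n x + ph φ n x * TT φ n x := by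
  rw [QT, QT, Finset.sum_range_succ]

theorem QT_succ' (n : ℕ) (x : A) :
    QT φ (n + 1) x = QT φ n (ph φ 1 x) + x * TT φ n (ph φ 1 x) := by
  induction n with
  | zero => simp [QT, TT_apply]
  | succ n ih =>
    rw [QT_succ, ih, QT_succ, TT_succ', TT_succ, Nat.cast_add, Nat.cast_one, ph_add]
    ring

theorem QT_ph1 (n : ℕ) {x : A} (hx : x ∈ Fx φ n) : QT φ n (ph φ 1 x) = QT φ n x := by
  have h1 := QT_succ φ n x
  rw [QT_succ', (mem_Fx φ).1 hx, TT_ph φ n hx] at h1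
  exact add_right_cancel h1

theorem QT_ph (n : ℕ) {x : A} (hx : x ∈ Fx φ n) (j : ℕ) : QT φ n (ph φ j x) = QT φ n x := by
  induction j with
  | zero => simp [ph_zero]
  | succ j ih =>
    rw [Nat.cast_succ, add_comm, ph_add, QT_ph1 φ n (ph_mem_Fx φ hx _), ih]

theorem QT_add [CharP A 2] (n : ℕ) (x y : A) :
    QT φ n (x + y) = QT φ n x + QT φ n y + (TT φ n x * TT φ n y + TT φ n (x * y)) := by
  induction n with
  | zero => simp [QT, TT_apply]
  | succ n ih =>
    simp only [QT_succ, ih, TT_succ, map_add, map_mul (ph φ n)]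
    have := CharTwo.add_self_eq_zero (ph φ n x * ph φ n y)
    linear_combination -this

theorem QT_sum [CharP A 2] (n e : ℕ) (c : ℕ → A) :
    QT φ n (∑ i ∈ Finset.range (e + 1), c i) = ∑ i ∈ Finset.range (e + 1), QT φ n (c i)
      + S2 e (fun i j => TT φ n (c i) * TT φ n (c j)) + TT φ n (S2 e (fun i j => c i * c j)) := by
  induction e with
  | zero => simp [S2]
  | succ e ih =>
    rw [Finset.sum_range_succ, QT_add, ih, Finset.sum_range_succ _ (e + 1), S2_succ, S2_succ,
      map_add, map_sum, ← Finset.sum_mul, ← Finset.sum_mul]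
    ring

theorem QT_zero (n : ℕ) : QT φ n (0 : A) = 0 := by simp [QT]

theorem key1 [CharP A 2] (n e : ℕ) (c d : ℕ → A) (hd : ∀ i, d i ∈ Fx φ n)
    (hcd : ∀ i : ℕ, c i = ph φ i (d i)) (hc0 : ∑ i ∈ Finset.range (e + 1), c i = 0)
    (hd0 : ∑ i ∈ Finset.range (e + 1), d i = 0) :
    TT φ n (S2 e (fun i j => c i * c j)) = TT φ n (S2 e (fun i j => d i * d j)) := by
  have h1 := QT_sum φ n e c
  have h2 := QT_sum φ n e d
  rw [hc0, QT_zero] at h1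
  rw [hd0, QT_zero] at h2
  have h3 : ∀ i, QT φ n (c i) = QT φ n (d i) := fun i => by rw [hcd, QT_ph φ n (hd i)]
  have h4 : ∀ i, TT φ n (c i) = TT φ n (d i) := fun i => by rw [hcd, TT_ph φ n (hd i)]
  simp only [h3, h4] at h1
  linear_combination h2 - h1

/-- `γ_F` -/
def gam (e : ℕ) (b : ℕ → A) : A := S2 e (fun i j => ph φ (-i) (b i) * ph φ (-j) (b j))

theorem gam_mem {n e : ℕ} {b : ℕ → A} (hb : ∀ i, b i ∈ Fx φ n) : gam φ e b ∈ Fx φ n := by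
  rw [gam, S2]
  exact Submodule.sum_mem _ fun j _ => Submodule.sum_mem _ fun i _ =>
    mul_mem_Fx φ (ph_mem_Fx φ (hb _) _) (ph_mem_Fx φ (hb _) _)

theorem key2 [CharP A 2] (n e : ℕ) (a b : ℕ → A) (hb : ∀ i, b i ∈ Fx φ n)
    (hab : ∀ r, 1 ≤ r → r ≤ e → a r = aR φ e b r) (hb1 : PS φ e b 1 = 0) {v : A}
    (hv : v ∈ Fx φ n) (hF : PL φ e b v = 0) :
    TT φ n (v * PL φ e a v) = TT φ n ((a 0 + gam φ e b) * v ^ 2) := by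
  have h1 := key1 φ n e (fun i => b i * ph φ i v) (fun i => ph φ (-i) (b i) * v)
    (fun i => mul_mem_Fx φ (ph_mem_Fx φ (hb i) _) hv)
    (fun i => by rw [map_mul (ph φ _), ph_cancel_neg])
    (by rw [← hF, PL_apply])
    (by
      rw [PS_apply] at hb1
      simp only [mul_one] at hb1
      rw [← Finset.sum_mul, hb1, zero_mul])
  have h2 : S2 e (fun i j => ph φ (-i) (b i) * v * (ph φ (-j) (b j) * v)) = gam φ e b * v ^ 2 := by
    simp only [gam, S2, Finset.sum_mul]
    refine Finset.sum_congr rfl fun r _ => Finset.sum_congr rfl fun i _ => ?_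
    ring
  rw [h2] at h1
  rw [add_mul, map_add, ← h1, PL_apply, Finset.sum_range_succ', mul_add, map_add, add_comm]
  congr 1
  · simp only [Nat.cast_zero, ph_zero]; congr 1; ring
  · rw [Finset.mul_sum, map_sum, S2, map_sum]
    refine Finset.sum_congr rfl fun r hr => ?_
    simp at hr
    rw [hab _ (by omega) (by omega), aR, show e - (r + 1) + 1 = e - r by omega, Finset.sum_mul,
      Finset.mul_sum, map_sum, map_sum]
    refine Finset.sum_congr rfl fun i _ => ?_
    rw [← TT_ph φ n (x := v * _) (mul_mem_Fx φ hv (mul_mem_Fx φ (ph_mem_Fx φ (mul_mem_Fx φ (hb _) (hb _)) _)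
      (ph_mem_Fx φ hv _))) i, map_mul (ph φ _), map_mul (ph φ _), ph_cancel_neg, ← ph_add]
    congr 1
    push_cast
    ring_nf

theorem TT_sq [CharP A 2] (n : ℕ) (x : A) : TT φ n (x ^ 2) = TT φ n x ^ 2 := by
  rw [TT_apply, TT_apply, CharTwo.sum_sq]
  exact Finset.sum_congr rfl fun i _ => map_pow _ _ _

theorem TT_double (n : ℕ) (x : A) : TT φ (2 * n) x = TT φ n (x + ph φ n x) := by
  rw [map_add, TT_apply, TT_apply, TT_apply, two_mul, Finset.sum_range_add]
  congr 1
  refine Finset.sum_congr rfl fun i _ => ?_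
  rw [← ph_add, add_comm n i]; push_cast; rfl

theorem Fx_double {n : ℕ} {x : A} (hx : x ∈ Fx φ n) : x ∈ Fx φ (2 * n) := by
  rw [mem_Fx] at *
  rw [two_mul, Nat.cast_add, ph_add, hx, hx]

theorem N_mem {n : ℕ} {x : A} (hx : x ∈ Fx φ (2 * n)) : ph φ n x + x ∈ Fx φ n := by
  rw [mem_Fx] at *
  rw [map_add, ← ph_add, ← Nat.cast_add, ← two_mul, hx, add_comm]

theorem mem_of_N [CharP A 2] {n : ℕ} {x : A} (h : ph φ n x + x = 0) : x ∈ Fx φ n := by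
  rw [mem_Fx]; exact CharTwo.add_eq_zero.1 h

theorem mem_of_NN [CharP A 2] {n : ℕ} {x : A} (h : ph φ n x + x ∈ Fx φ n) : x ∈ Fx φ (2 * n) := by
  rw [mem_Fx] at *
  rw [map_add, ← ph_add, ← Nat.cast_add, ← two_mul, add_comm] at h
  exact add_left_cancel h

theorem tr_red [CharP A 2] {n e : ℕ} {a : ℕ → A} (ha : ∀ i, a i ∈ Fx φ n) {u : A}
    (hu : u ∈ Fx φ (2 * n)) :
    TT φ (2 * n) ((ph φ n u + u) * PL φ e a u) =
      TT φ n ((ph φ n u + u) * PL φ e a (ph φ n u + u)) := by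
  rw [TT_double, map_mul (ph φ n), (mem_Fx φ).1 (N_mem φ hu), ← PL_ph φ ha, ← mul_add,
    ← map_add, add_comm u]

variable [IsAlgClosed A] [CharP A 2]

theorem exists_theta (hφ : ∀ x, ph φ 1 x = x ^ 2 ^ k) (hk : 1 ≤ k) {n : ℕ} (hn : 1 ≤ n) :
    ∃ θ : A, θ ∈ Fx φ (2 * n) ∧ ph φ n θ + θ = 1 := by
  have h : ∃ x ∈ Fx φ (2 * n), x ∉ Fx φ n := by
    by_contra hcon
    push Not at hcon
    haveI := fd_of_fin φ _ (Fx_fin φ hφ hk hn)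
    have := Submodule.finrank_mono (show Fx φ (2 * n) ≤ Fx φ n from hcon)
    rw [Fx_fr φ hφ hk hn, Fx_fr φ hφ hk (by omega)] at this
    omega
  obtain ⟨x, hx, hx'⟩ := h
  have hw : ph φ n x + x ≠ 0 := fun h => hx' (mem_of_N φ h)
  have hwm := (mem_Fx φ).1 (N_mem φ hx)
  have hN : ph φ n (x / (ph φ n x + x)) + x / (ph φ n x + x) = 1 := by
    rw [map_div₀, hwm, ← add_div, div_self hw]
  refine ⟨x / (ph φ n x + x), ?_, hN⟩
  apply mem_of_NN
  rw [hN, mem_Fx, map_one]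

/-- trace form -/
def BT (n : ℕ) : LinearMap.BilinForm (k0 φ) (Fx φ n) :=
  LinearMap.mk₂ (k0 φ) (fun x y => ⟨TT φ n (x * y), TT_mem φ n (mul_mem_Fx φ x.2 y.2)⟩)
    (fun x y z => Subtype.ext (by simp [add_mul]))
    (fun c x y => Subtype.ext (by
      show TT φ n ((c • (x : A)) * y) = c • TT φ n (x * y)
      rw [smul_mul_assoc, map_smul]))
    (fun x y z => Subtype.ext (by simp [mul_add]))
    (fun c x y => Subtype.ext (by
      show TT φ n ((x : A) * (c • (y : A))) = c • TT φ n (x * y)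
      rw [mul_smul_comm, map_smul]))

theorem BT_apply (n : ℕ) (x y : Fx φ n) : (BT φ n x y : A) = TT φ n (x * y) := rfl

theorem BT_symm (n : ℕ) (x y : Fx φ n) : BT φ n x y = BT φ n y x :=
  Subtype.ext (by rw [BT_apply, BT_apply, mul_comm])

theorem TT_eq_PL {n : ℕ} (hn : 1 ≤ n) : TT φ n = PL φ (n - 1) (fun _ => 1) := by
  ext x
  rw [TT_apply, PL_apply, show n - 1 + 1 = n by omega]
  simp

theorem TT_ndg (hφ : ∀ x, ph φ 1 x = x ^ 2 ^ k) (hk : 1 ≤ k) {n : ℕ} (hn : 1 ≤ n) {x : A}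
    (hx : x ∈ Fx φ n) (h : ∀ y ∈ Fx φ n, TT φ n (x * y) = 0) : x = 0 := by
  by_contra hne
  have h1 : Fx φ n ≤ LinearMap.ker (PL φ (n - 1) (fun _ => 1)) := by
    intro z hz
    rw [LinearMap.mem_ker, ← TT_eq_PL φ hn]
    have := h (x⁻¹ * z) (mul_mem_Fx φ (by
      rw [mem_Fx] at *; rw [map_inv₀, hx]) hz)
    rwa [mul_inv_cancel_left₀ hne] at this
  have hex : ∃ i ≤ n - 1, (fun _ : ℕ => (1 : A)) i ≠ 0 := ⟨0, by omega, one_ne_zero⟩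
  haveI := fd_of_fin φ _ (PL_fin φ hφ hk (n - 1) (fun _ => 1) hex)
  have h2 := Submodule.finrank_mono h1
  have h3 := PL_le φ hφ hk (n - 1) (fun _ => 1) hex
  rw [Fx_fr φ hφ hk hn] at h2
  omega

theorem BT_ndg (hφ : ∀ x, ph φ 1 x = x ^ 2 ^ k) (hk : 1 ≤ k) {n : ℕ} (hn : 1 ≤ n) :
    (BT φ n).Nondegenerate := by
  have h : ∀ x : Fx φ n, (∀ y, BT φ n x y = 0) → x = 0 := by
    intro x hx
    refine Subtype.ext (TT_ndg φ hφ hk hn x.2 fun y hy => ?_)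
    have := congrArg Subtype.val (hx ⟨y, hy⟩)
    exact this
  exact ⟨h, fun x hx => h x fun y => by rw [BT_symm]; exact hx y⟩

theorem fr_comap (n : ℕ) (f : A →ₗ[k0 φ] A) (hf : ∀ x ∈ Fx φ n, f x ∈ Fx φ n) :
    Module.finrank (k0 φ) (LinearMap.ker (f.restrict hf)) =
      Module.finrank (k0 φ) (Fx φ n ⊓ LinearMap.ker f : Submodule (k0 φ) A) := by
  have : Submodule.map (Fx φ n).subtype (LinearMap.ker (f.restrict hf)) =
      Fx φ n ⊓ LinearMap.ker f := by
    ext x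
    simp only [Submodule.mem_map, LinearMap.mem_ker, Submodule.mem_inf]
    constructor
    · rintro ⟨y, hy, rfl⟩
      exact ⟨y.2, congrArg Subtype.val hy⟩
    · rintro ⟨h1, h2⟩
      exact ⟨⟨x, h1⟩, Subtype.ext h2, rfl⟩
  rw [← this, Submodule.finrank_map_subtype_eq]

theorem pair_fr (hφ : ∀ x, ph φ 1 x = x ^ 2 ^ k) (hk : 1 ≤ k) {n : ℕ} (hn : 1 ≤ n)
    (f g : A →ₗ[k0 φ] A) (hf : ∀ x ∈ Fx φ n, f x ∈ Fx φ n) (hg : ∀ x ∈ Fx φ n, g x ∈ Fx φ n)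
    (hfg : ∀ x ∈ Fx φ n, ∀ y ∈ Fx φ n, TT φ n (f x * y) = TT φ n (x * g y)) :
    Module.finrank (k0 φ) (Fx φ n ⊓ LinearMap.ker f : Submodule (k0 φ) A) =
    Module.finrank (k0 φ) (Fx φ n ⊓ LinearMap.ker g : Submodule (k0 φ) A) ∧
    ∀ z ∈ Fx φ n, (∀ x ∈ Fx φ n, f x = 0 → TT φ n (x * z) = 0) → ∃ y ∈ Fx φ n, g y = z := by
  haveI := fd_of_fin φ _ (Fx_fin φ hφ hk hn)
  have h := la_adj (BT φ n) (BT_ndg φ hφ hk hn) (BT_symm φ n) (f.restrict hf) (g.restrict hg)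
    (fun x y => Subtype.ext (hfg x x.2 y y.2))
  rw [fr_comap, fr_comap] at h
  refine ⟨h.1, fun z hz hzz => ?_⟩
  have : (⟨z, hz⟩ : Fx φ n) ∈ LinearMap.range (g.restrict hg) := by
    rw [h.2, LinearMap.BilinForm.mem_orthogonal_iff]
    intro x hx
    exact Subtype.ext (hzz x x.2 (congrArg Subtype.val hx))
  obtain ⟨y, hy⟩ := this
  exact ⟨y, y.2, congrArg Subtype.val hy⟩

/-- dimension of the trace-perp -/
theorem perp_fr (hφ : ∀ x, ph φ 1 x = x ^ 2 ^ k) (hk : 1 ≤ k) {n : ℕ} (hn : 1 ≤ n)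
    (L : Submodule (k0 φ) A) (hL : L ≤ Fx φ n) :
    ∃ P : Submodule (k0 φ) A, P ≤ Fx φ n ∧ (∀ x ∈ Fx φ n, (∀ u ∈ L, TT φ n (u * x) = 0) → x ∈ P) ∧
      Module.finrank (k0 φ) P + Module.finrank (k0 φ) L = n := by
  haveI := fd_of_fin φ _ (Fx_fin φ hφ hk hn)
  let L' := L.comap (Fx φ n).subtype
  refine ⟨((BT φ n).orthogonal L').map (Fx φ n).subtype, ?_, ?_, ?_⟩
  · rintro _ ⟨y, _, rfl⟩; exact y.2
  · intro x hx h
    refine ⟨⟨x, hx⟩, ?_, rfl⟩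
    exact LinearMap.BilinForm.mem_orthogonal_iff.2 fun u hu => Subtype.ext (h u hu)
  · rw [Submodule.finrank_map_subtype_eq, LinearMap.BilinForm.finrank_orthogonal (BT_ndg φ hφ hk hn),
      Fx_fr φ hφ hk hn]
    have h1 : Module.finrank (k0 φ) L' = Module.finrank (k0 φ) L := by
      rw [← Submodule.finrank_map_subtype_eq, Submodule.map_comap_subtype, inf_eq_right.2 hL]
    have h2 := Submodule.finrank_le L'
    rw [Fx_fr φ hφ hk hn] at h2
    omega

end pairing

section main

variable {A : Type*} [Field A] (φ : RingAut A) {k : ℕ}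

theorem DD_congr (e : ℕ) {s s' : ℕ → A} (h : ∀ i, 1 ≤ i → i ≤ e → s i = s' i) (x : A) :
    DD φ e s x = DD φ e s' x := by
  rw [DD_apply, DD_apply]
  refine Finset.sum_congr rfl fun i hi => ?_
  simp at hi
  rw [h (i + 1) (by omega) (by omega)]

variable [IsAlgClosed A] [CharP A 2]

theorem le_of_fr (S T : Submodule (k0 φ) A) (hS : (S : Set A).Finite)
    (h : Module.finrank (k0 φ) (T ⊓ S : Submodule (k0 φ) A) = Module.finrank (k0 φ) S) :
    S ≤ T := by
  haveI := fd_of_fin φ S hS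
  have := Submodule.eq_of_le_of_finrank_eq (inf_le_right : T ⊓ S ≤ S) h
  rw [← this]; exact inf_le_left

theorem PS_fin (hφ : ∀ x, ph φ 1 x = x ^ 2 ^ k) (hk : 1 ≤ k) (e : ℕ) (b : ℕ → A)
    (h0 : b 0 ≠ 0) : (LinearMap.ker (PS φ e b) : Set A).Finite := by
  rw [PS_ker]
  exact PL_fin φ hφ hk _ _ ⟨e, le_rfl, by
    simp only [Nat.sub_self]; exact (map_ne_zero (ph φ _)).2 h0⟩

theorem PS_fr (hφ : ∀ x, ph φ 1 x = x ^ 2 ^ k) (hk : 1 ≤ k) (e : ℕ) (b : ℕ → A)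
    (h0 : b 0 ≠ 0) (he : b e ≠ 0) : Module.finrank (k0 φ) (LinearMap.ker (PS φ e b)) = e := by
  rw [PS_ker]
  refine PL_fr φ hφ hk _ _ ?_ ?_
  · exact (map_ne_zero (ph φ _)).2 (by simpa using he)
  · simp only [Nat.sub_self]; exact (map_ne_zero (ph φ _)).2 h0

theorem ker_iff (hφ : ∀ x, ph φ 1 x = x ^ 2 ^ k) (hk : 1 ≤ k) {m : ℕ} (hm : 1 ≤ m) (e : ℕ)
    (b : ℕ → A) (hb : ∀ i, b i ∈ Fx φ m) (h0 : b 0 ≠ 0) (he : b e ≠ 0) :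
    LinearMap.ker (PS φ e b) ≤ Fx φ m ↔ LinearMap.ker (PL φ e b) ≤ Fx φ m := by
  have h := (pair_fr φ hφ hk hm (PL φ e b) (PS φ e b) (fun x hx => PL_mem φ hb hx)
    (fun x hx => PS_mem φ hb hx) (fun x hx y hy => PL_adj φ hb hx hy)).1
  have h1 := PS_fr φ hφ hk e b h0 he
  have h2 := PL_fr φ hφ hk e b h0 he
  constructor
  · intro hle
    apply le_of_fr φ _ _ (PL_fin φ hφ hk e b ⟨0, by omega, h0⟩)
    rw [h, inf_eq_right.2 hle, h1, h2]
  · intro hle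
    apply le_of_fr φ _ _ (PS_fin φ hφ hk e b h0)
    rw [← h, inf_eq_right.2 hle, h1, h2]

theorem fwd (hφ : ∀ x, ph φ 1 x = x ^ 2 ^ k) (hk : 1 ≤ k) {m : ℕ} (hm : 1 ≤ m) (e : ℕ)
    (a : ℕ → A) (ha : ∀ i, a i ∈ Fx φ m)
    (b : ℕ → A) (hb : ∀ i, b i ∈ Fx φ m) (t : A) (ht : t ∈ Fx φ m) (h0e : b 0 * b e ≠ 0)
    (hb1 : PS φ e b 1 = 0) (hker : ∀ x, PS φ e b x = 0 → x ∈ Fx φ m)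
    (har : ∀ r, 1 ≤ r → r ≤ e → a r = aR φ e b r)
    (ha0 : a 0 = gam φ e b + (PS φ e b t) ^ 2) (u : A) (hu : DD φ e a u = 0) :
    u ∈ Fx φ (2 * m) ∧ TT φ (2 * m) ((ph φ m u + u) * PL φ e a u) = 0 := by
  have h0 := left_ne_zero_of_mul h0e
  have he := right_ne_zero_of_mul h0e
  have hF := (ker_iff φ hφ hk hm e b hb h0 he).1 hker
  have h1 := FF_eq φ e b u
  rw [hb1, ← DD_congr φ e har, hu] at h1
  have h2 := hker _ (by rw [h1]; ring)
  have h3 : PL φ e b (ph φ m u + u) = 0 := by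
    rw [map_add, PL_ph φ hb, (mem_Fx φ).1 h2, CharTwo.add_self_eq_zero]
  have h4 : ph φ m u + u ∈ Fx φ m := hF h3
  have h5 := mem_of_NN φ h4
  refine ⟨h5, ?_⟩
  rw [tr_red φ ha h5, key2 φ m e a b hb har hb1 h4 h3, ha0]
  have h6 : gam φ e b + PS φ e b t ^ 2 + gam φ e b = PS φ e b t ^ 2 := by
    linear_combination CharTwo.add_self_eq_zero (gam φ e b)
  rw [h6, ← mul_pow, TT_sq, mul_comm, ← PL_adj φ hb h4 ht, h3, zero_mul, map_zero]
  simp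

/-- square roots in the fixed field -/
theorem exists_sq {n : ℕ} {x : A} (hx : x ∈ Fx φ n) : ∃ y ∈ Fx φ n, y ^ 2 = x := by
  obtain ⟨y, hy⟩ := IsAlgClosed.exists_pow_nat_eq x (n := 2) (by norm_num)
  refine ⟨y, ?_, hy⟩
  rw [mem_Fx] at *
  rw [← hy, map_pow] at hx
  have h : (ph φ n y + y) ^ 2 = 0 := by
    rw [CharTwo.add_sq, hx, CharTwo.add_self_eq_zero]
  exact CharTwo.add_eq_zero.1 (pow_eq_zero_iff (by norm_num) |>.1 h)

/-- the polynomial with prescribed kernel -/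
theorem exists_F (hφ : ∀ x, ph φ 1 x = x ^ 2 ^ k) (hk : 1 ≤ k) {m : ℕ} (e : ℕ) (he : 1 ≤ e)
    (L : Submodule (k0 φ) A) (hL : L ≤ Fx φ m) (hLf : (L : Set A).Finite)
    (hLe : Module.finrank (k0 φ) L = e) :
    ∃ b : ℕ → A, (∀ i, b i ∈ Fx φ m) ∧ b 0 ≠ 0 ∧ b e ≠ 0 ∧ LinearMap.ker (PL φ e b) = L := by
  haveI := fd_of_fin φ L hLf
  let Kq : Subfield A := RingHom.eqLocusField (ph φ m) (RingHom.id A)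
  have hKq : ∀ x : A, x ∈ Kq ↔ x ∈ Fx φ m := fun x => (mem_Fx φ).symm
  let l := Module.finBasisOfFinrankEq (k0 φ) L hLe
  let T : (Fin (e + 1) → Kq) →ₗ[Kq] (Fin e → Kq) :=
    LinearMap.pi fun j => ∑ i : Fin (e + 1),
      (⟨ph φ (i : ℕ) (l j), (hKq _).2 (ph_mem_Fx φ (hL (l j).2) _)⟩ : Kq) •
        LinearMap.proj (R := Kq) (φ := fun _ : Fin (e + 1) => Kq) i
  have hT := LinearMap.ker_ne_bot_of_finrank_lt (f := T) (by simp)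
  obtain ⟨c, hc, hc0⟩ := Submodule.exists_mem_ne_zero_of_ne_bot hT
  let b : ℕ → A := fun i => if h : i < e + 1 then (c ⟨i, h⟩ : A) else 0
  have hb : ∀ i, b i ∈ Fx φ m := by
    intro i
    by_cases h : i < e + 1
    · simp only [b, h, dif_pos]; exact (hKq _).1 (c _).2
    · simp only [b, h]; exact Submodule.zero_mem _
  have hbas : ∀ j, PL φ e b (l j) = 0 := by
    intro j
    have h1 : T c j = 0 := by rw [LinearMap.mem_ker.1 hc]; rfl
    have h2 := congrArg Subtype.val h1
    simp only [T, LinearMap.pi_apply, LinearMap.sum_apply, LinearMap.smul_apply,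
      LinearMap.proj_apply, smul_eq_mul] at h2
    rw [PL_apply, Finset.sum_range]
    refine Eq.trans ?_ (h2.trans rfl)
    push_cast
    refine Finset.sum_congr rfl fun i _ => ?_
    simp only [b, i.2, dif_pos, Fin.eta]
    exact mul_comm _ _
  have hLk : L ≤ LinearMap.ker (PL φ e b) := by
    intro x hx
    have h1 : (PL φ e b ∘ₗ L.subtype) = 0 := l.ext fun j => hbas j
    exact LinearMap.congr_fun h1 ⟨x, hx⟩
  have hex : ∃ i ≤ e, b i ≠ 0 := by
    by_contra hcon
    push Not at hcon
    apply hc0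
    ext i
    have := hcon i (by omega)
    simpa [b, Nat.lt_succ_iff.1 i.2] using this
  have hbe : b e ≠ 0 := by
    intro h
    have hex' : ∃ i ≤ e - 1, b i ≠ 0 := by
      obtain ⟨i, hi, hi'⟩ := hex
      refine ⟨i, ?_, hi'⟩
      rcases Nat.lt_or_ge i e with h' | h'
      · omega
      · exact absurd (by rw [show i = e by omega]; exact h) hi'
    haveI := fd_of_fin φ _ (PL_fin φ hφ hk (e - 1) b hex')
    have hle : L ≤ LinearMap.ker (PL φ (e - 1) b) := by
      intro x hx
      have := hLk hx
      rw [LinearMap.mem_ker, PL_apply] at *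
      rw [Finset.sum_range_succ, h, zero_mul, add_zero] at this
      rwa [show e - 1 + 1 = e by omega]
    have h1 := Submodule.finrank_mono hle
    have h2 := PL_le φ hφ hk (e - 1) b hex'
    omega
  have hb0 : b 0 ≠ 0 := by
    intro h
    have hex' : ∃ i ≤ e - 1, b (i + 1) ≠ 0 := ⟨e - 1, le_rfl, by rwa [show e - 1 + 1 = e by omega]⟩
    haveI := fd_of_fin φ _ (PL_fin φ hφ hk (e - 1) (fun i => b (i + 1)) hex')
    have hle : L.map (phL φ 1) ≤ LinearMap.ker (PL φ (e - 1) (fun i => b (i + 1))) := by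
      rintro _ ⟨x, hx, rfl⟩
      have := hLk hx
      rw [LinearMap.mem_ker, PL_apply] at *
      rw [Finset.sum_range_succ', h, zero_mul, add_zero] at this
      rw [show e - 1 + 1 = e by omega, ← this]
      refine Finset.sum_congr rfl fun i _ => ?_
      rw [phL_apply, ← ph_add]; push_cast; rfl
    have hinj : Function.Injective (phL φ 1) := (ph φ 1).injective
    have h1 := Submodule.finrank_mono hle
    have h2 := PL_le φ hφ hk (e - 1) (fun i => b (i + 1)) hex'
    have h3 := (Submodule.equivMapOfInjective (phL φ 1) hinj L).finrank_eq
    omega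
  refine ⟨b, hb, hb0, hbe, ?_⟩
  haveI := fd_of_fin φ _ (PL_fin φ hφ hk e b hex)
  exact (Submodule.eq_of_le_of_finrank_eq hLk (by rw [hLe, PL_fr φ hφ hk e b hb0 hbe])).symm

end main

section isotropic

variable {A : Type*} [Field A] (φ : RingAut A) {k : ℕ} [IsAlgClosed A] [CharP A 2]

/-- square root -/
def sqr (x : A) : A := (frobeniusEquiv A 2).symm x

theorem sqr_sq (x : A) : sqr x ^ 2 = x := frobeniusEquiv_symm_pow_p A 2 x

theorem sq_inj {x y : A} (h : x ^ 2 = y ^ 2) : x = y := by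
  have : (x + y) ^ 2 = 0 := by rw [CharTwo.add_sq, h, CharTwo.add_self_eq_zero]
  exact CharTwo.add_eq_zero.1 (pow_eq_zero_iff (by norm_num) |>.1 this)

theorem sqr_mem {x : A} (hx : x ∈ k0 φ) : sqr x ∈ k0 φ := by
  rw [mem_k0] at *
  apply sq_inj
  rw [← map_pow, sqr_sq, hx]

theorem Nth {m : ℕ} {θ v : A} (hθ1 : ph φ m θ + θ = 1) (hv : v ∈ Fx φ m) :
    ph φ m (θ * v) + θ * v = v := by
  rw [map_mul (ph φ _), (mem_Fx φ).1 hv, ← add_mul, hθ1, one_mul]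

theorem thD {m e : ℕ} {a : ℕ → A} (ha : ∀ i, a i ∈ Fx φ m) {θ v : A}
    (hθ1 : ph φ m θ + θ = 1) (hv : v ∈ Fx φ m) (hD : DD φ e a v = 0) :
    DD φ e a (θ * v) ∈ Fx φ m := by
  apply mem_of_N
  rw [← DD_ph φ ha, ← map_add, Nth φ hθ1 hv, hD]

theorem DD_alt {m e : ℕ} {a : ℕ → A} (ha : ∀ i, a i ∈ Fx φ m) {x : A} (hx : x ∈ Fx φ m) :
    TT φ m (x * DD φ e a x) = 0 := by
  rw [← R_eq_DD, mul_add, map_add, ← PL_adj φ ha hx hx, mul_comm, CharTwo.add_self_eq_zero]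

theorem Q_add {m e : ℕ} {a : ℕ → A} (ha : ∀ i, a i ∈ Fx φ m) {u v : A} (hu : u ∈ Fx φ m)
    (hv : v ∈ Fx φ m) (hD : DD φ e a v = 0) :
    TT φ m ((u + v) * PL φ e a (u + v)) = TT φ m (u * PL φ e a u) + TT φ m (v * PL φ e a v) := by
  have h1 : TT φ m (v * PL φ e a u) + TT φ m (u * PL φ e a v) = 0 := by
    rw [mul_comm v, PL_adj φ ha hu hv, ← map_add, ← mul_add, add_comm, R_eq_DD, hD, mul_zero,
      map_zero]
  rw [map_add (PL φ e a), mul_add, add_mul, add_mul]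
  simp only [map_add]
  linear_combination h1

/-- the space `W = V ∩ F_q` -/
def WW (m e : ℕ) (a : ℕ → A) : Submodule (k0 φ) A := Fx φ m ⊓ LinearMap.ker (DD φ e a)

/-- the form `Ω` -/
def Om {m e : ℕ} {a : ℕ → A} (ha : ∀ i, a i ∈ Fx φ m) {θ : A} (hθ1 : ph φ m θ + θ = 1) :
    LinearMap.BilinForm (k0 φ) (WW φ m e a) :=
  LinearMap.mk₂ (k0 φ) (fun u v => ⟨TT φ m (u * DD φ e a (θ * v)),
      TT_mem φ m (mul_mem_Fx φ u.2.1 (thD φ ha hθ1 v.2.1 v.2.2))⟩)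
    (fun x y z => Subtype.ext (by simp [add_mul]))
    (fun c x y => Subtype.ext (by
      show TT φ m ((c • (x : A)) * _) = c • TT φ m (x * _)
      rw [smul_mul_assoc, map_smul]))
    (fun x y z => Subtype.ext (by simp [mul_add]))
    (fun c x y => Subtype.ext (by
      show TT φ m ((x : A) * DD φ e a (θ * (c • (y : A)))) = c • TT φ m (x * DD φ e a (θ * y))
      rw [mul_smul_comm, map_smul, mul_smul_comm, map_smul]))

theorem Om_apply {m e : ℕ} {a : ℕ → A} (ha : ∀ i, a i ∈ Fx φ m) {θ : A}
    (hθ1 : ph φ m θ + θ = 1) (u v : WW φ m e a) :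
    (Om φ ha hθ1 u v : A) = TT φ m (u * DD φ e a (θ * v)) := rfl

/-- the functional -/
def ff {m e : ℕ} {a : ℕ → A} (ha : ∀ i, a i ∈ Fx φ m) : WW φ m e a →ₗ[k0 φ] k0 φ where
  toFun v := ⟨sqr (TT φ m (v * PL φ e a v)),
    sqr_mem φ (TT_mem φ m (mul_mem_Fx φ v.2.1 (PL_mem φ ha v.2.1)))⟩
  map_add' u v := Subtype.ext (by
    show sqr (TT φ m (((u : A) + v) * PL φ e a ((u : A) + v))) = sqr _ + sqr _
    rw [Q_add φ ha u.2.1 v.2.1 v.2.2]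
    exact map_add (frobeniusEquiv A 2).symm _ _)
  map_smul' c v := Subtype.ext (by
    show sqr (TT φ m ((c • (v : A)) * PL φ e a (c • (v : A)))) = c * sqr (TT φ m (v * PL φ e a v))
    apply sq_inj
    rw [mul_pow, sqr_sq, sqr_sq, map_smul, smul_mul_smul_comm, map_smul, ← sq]
    rfl)

theorem exists_L (hφ : ∀ x, ph φ 1 x = x ^ 2 ^ k) (hk : 1 ≤ k) {m : ℕ} (hm : 1 ≤ m) (e : ℕ)
    (he : 1 ≤ e) (a : ℕ → A) (ha : ∀ i, a i ∈ Fx φ m) (hae : a e ≠ 0)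
    {θ : A} (hθ : θ ∈ Fx φ (2 * m)) (hθ1 : ph φ m θ + θ = 1)
    (hV : ∀ u, DD φ e a u = 0 → u ∈ Fx φ (2 * m))
    (hTr : ∀ u, DD φ e a u = 0 → TT φ (2 * m) ((ph φ m u + u) * PL φ e a u) = 0) :
    ∃ L : Submodule (k0 φ) A, L ≤ Fx φ m ∧ (∀ v ∈ L, DD φ e a v = 0) ∧
      (∀ u ∈ L, ∀ v ∈ L, TT φ m (u * DD φ e a (θ * v)) = 0) ∧
      (∀ v ∈ L, TT φ m (v * PL φ e a v) = 0) ∧ Module.finrank (k0 φ) L = e := by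
  haveI hVfd := fd_of_fin φ _ (DD_fin φ hφ hk e he a hae)
  haveI hXfd := fd_of_fin φ _ (Fx_fin φ hφ hk hm)
  haveI : FiniteDimensional (k0 φ) (WW φ m e a) :=
    fd_of_fin φ _ ((Fx_fin φ hφ hk hm).subset fun x hx => hx.1)
  have ha2 : ∀ i, a i ∈ Fx φ (2 * m) := fun i => Fx_double φ (ha i)
  let B := Om φ (e := e) ha hθ1
  let Nl : A →ₗ[k0 φ] A := phL φ m + LinearMap.id
  have hNl : ∀ x, Nl x = ph φ m x + x := fun x => rfl
  have halt : B.IsAlt := by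
    intro v
    refine Subtype.ext ?_
    show TT φ m (v * DD φ e a (θ * v)) = 0
    have hv1 : (v : A) ∈ Fx φ m := v.2.1
    have hv2 : DD φ e a v = 0 := v.2.2
    have h1 := DD_alt φ (e := e) ha2 (mul_mem_Fx φ hθ (Fx_double φ hv1))
    rw [TT_double, map_mul (ph φ m) (θ * v), (mem_Fx φ).1 (thD φ ha hθ1 hv1 hv2), ← add_mul,
      add_comm, Nth φ hθ1 hv1] at h1
    exact h1
  have hrad : (B.orthogonal ⊤).map (WW φ m e a).subtype =
      (LinearMap.ker (DD φ e a)).map Nl := by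
    ext v
    constructor
    · rintro ⟨v, hv, rfl⟩
      have hv1 : (v : A) ∈ Fx φ m := v.2.1
      have hv2 : DD φ e a v = 0 := v.2.2
      have hv3 : ∀ u ∈ Fx φ m, DD φ e a u = 0 → TT φ m (u * DD φ e a (θ * v)) = 0 := by
        intro u hu hu'
        exact congrArg Subtype.val
          (LinearMap.BilinForm.mem_orthogonal_iff.1 hv ⟨u, hu, hu'⟩ trivial)
      obtain ⟨y, hy, hy'⟩ := (pair_fr φ hφ hk hm (DD φ e a) (DD φ e a)
        (fun x hx => DD_mem φ ha hx) (fun x hx => DD_mem φ ha hx)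
        (fun x hx y hy => DD_adj φ ha hx hy)).2 _ (thD φ ha hθ1 hv1 hv2) hv3
      refine ⟨θ * v + y, ?_, ?_⟩
      · show DD φ e a _ = 0
        rw [map_add, hy', CharTwo.add_self_eq_zero]
      · show ph φ m (θ * v + y) + (θ * v + y) = v
        rw [map_add, (mem_Fx φ).1 hy]
        linear_combination Nth φ hθ1 hv1 + CharTwo.add_self_eq_zero y
    · rintro ⟨x, hx, rfl⟩
      have hx' : DD φ e a x = 0 := hx
      have hv1 : ph φ m x + x ∈ Fx φ m := N_mem φ (hV x hx)
      have hv2 : DD φ e a (ph φ m x + x) = 0 := by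
        rw [map_add, DD_ph φ ha, hx', map_zero, add_zero]
      refine ⟨⟨ph φ m x + x, hv1, hv2⟩, ?_, rfl⟩
      refine LinearMap.BilinForm.mem_orthogonal_iff.2 fun u _ => Subtype.ext ?_
      show TT φ m (u * DD φ e a (θ * (ph φ m x + x))) = 0
      have hu1 : (u : A) ∈ Fx φ m := u.2.1
      have hu2 : DD φ e a u = 0 := u.2.2
      have hy : x + θ * (ph φ m x + x) ∈ Fx φ m := by
        apply mem_of_N
        rw [map_add]
        linear_combination Nth φ hθ1 hv1 + CharTwo.add_self_eq_zero (ph φ m x + x)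
      have h1 : DD φ e a (θ * (ph φ m x + x)) = DD φ e a (x + θ * (ph φ m x + x)) := by
        rw [map_add, hx', zero_add]
      rw [h1, ← DD_adj φ ha hu1 hy, hu2, zero_mul, map_zero]
  have hdim : Module.finrank (k0 φ) (WW φ m e a) + Module.finrank (k0 φ) (B.orthogonal ⊤) =
      2 * e := by
    have h1 := LinearMap.finrank_range_add_finrank_ker (Nl.domRestrict (LinearMap.ker (DD φ e a)))
    have h2 : (LinearMap.ker (Nl.domRestrict (LinearMap.ker (DD φ e a)))).map
        (LinearMap.ker (DD φ e a)).subtype = WW φ m e a := by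
      ext x
      constructor
      · rintro ⟨y, hy, rfl⟩
        exact ⟨mem_of_N φ hy, y.2⟩
      · rintro ⟨h1, h2⟩
        refine ⟨⟨x, h2⟩, ?_, rfl⟩
        show ph φ m x + x = 0
        rw [(mem_Fx φ).1 h1, CharTwo.add_self_eq_zero]
    rw [LinearMap.range_domRestrict, ← hrad, Submodule.finrank_map_subtype_eq,
      ← Submodule.finrank_map_subtype_eq _ (LinearMap.ker _), h2, DD_fr φ hφ hk e he a hae] at h1
    omega
  have hradf : B.orthogonal ⊤ ≤ LinearMap.ker (ff φ (e := e) ha) := by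
    intro v hv
    have : (v : A) ∈ (LinearMap.ker (DD φ e a)).map Nl := by
      rw [← hrad]; exact ⟨v, hv, rfl⟩
    obtain ⟨x, hx, hxv⟩ := this
    have h1 := hTr x hx
    rw [tr_red φ ha (hV x hx)] at h1
    refine Subtype.ext ?_
    show sqr (TT φ m (v * PL φ e a v)) = 0
    rw [← hxv, hNl, h1]
    exact map_zero (frobeniusEquiv A 2).symm
  obtain ⟨L, hL1, hL2, hL3⟩ := la_iso B halt (ff φ ha) e hdim hradf
  refine ⟨L.map (WW φ m e a).subtype, ?_, ?_, ?_, ?_, ?_⟩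
  · rintro _ ⟨v, _, rfl⟩; exact v.2.1
  · rintro _ ⟨v, _, rfl⟩; exact v.2.2
  · rintro _ ⟨u, hu, rfl⟩ _ ⟨v, hv, rfl⟩
    exact congrArg Subtype.val (hL2 u hu v hv)
  · rintro _ ⟨v, hv, rfl⟩
    have h1 : sqr (TT φ m (v * PL φ e a v)) = 0 := congrArg Subtype.val (hL1 hv)
    show TT φ m (v * PL φ e a v) = 0
    rw [← sqr_sq (TT φ m _), h1]; simp
  · rw [Submodule.finrank_map_subtype_eq, hL3]

end isotropic

section backward

variable {A : Type*} [Field A] (φ : RingAut A) {k : ℕ} [IsAlgClosed A] [CharP A 2]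

theorem PL_scale (e : ℕ) (b : ℕ → A) (d x : A) :
    PL φ e (fun i => d * b i) x = d * PL φ e b x := by
  rw [PL_apply, PL_apply, Finset.mul_sum]
  exact Finset.sum_congr rfl fun i _ => by ring

theorem DD_add (e : ℕ) (s s' : ℕ → A) (x : A) :
    DD φ e (fun i => s i + s' i) x = DD φ e s x + DD φ e s' x := by
  rw [DD_apply, DD_apply, DD_apply, ← Finset.sum_add_distrib]
  refine Finset.sum_congr rfl fun i _ => ?_
  rw [add_mul, add_mul, map_add]
  ring

theorem aR_top (e : ℕ) (b : ℕ → A) : aR φ e b e = b 0 * b e := by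
  simp [aR, ph_zero]

/-- the operator comparison step -/
theorem coef_eq (hφ : ∀ x, ph φ 1 x = x ^ 2 ^ k) (hk : 1 ≤ k) {m : ℕ} (hm : 1 ≤ m) (e : ℕ)
    (he : 1 ≤ e) (a : ℕ → A) (ha : ∀ i, a i ∈ Fx φ m)
    {θ : A} (hθ1 : ph φ m θ + θ = 1)
    (L : Submodule (k0 φ) A) (hL : L ≤ Fx φ m) (hLD : ∀ v ∈ L, DD φ e a v = 0)
    (hiso : ∀ u ∈ L, ∀ v ∈ L, TT φ m (u * DD φ e a (θ * v)) = 0)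
    (hLe : Module.finrank (k0 φ) L = e)
    (b : ℕ → A) (hb : ∀ i, b i ∈ Fx φ m) (hbL : ∀ v ∈ L, PL φ e b v = 0)
    (hbe : a e = b 0 * b e) :
    (∀ r, 1 ≤ r → r ≤ e → a r = aR φ e b r) ∧ PS φ e b 1 = 0 := by
  haveI hXfd := fd_of_fin φ _ (Fx_fin φ hφ hk hm)
  haveI hLfd : FiniteDimensional (k0 φ) L :=
    fd_of_fin φ _ ((Fx_fin φ hφ hk hm).subset fun x hx => hL hx)
  obtain ⟨P, hP1, hP2, hP3⟩ := perp_fr φ hφ hk hm L hL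
  haveI hPfd : FiniteDimensional (k0 φ) P :=
    fd_of_fin φ _ ((Fx_fin φ hφ hk hm).subset fun x hx => hP1 hx)
  let E : A →ₗ[k0 φ] A := DD φ e a + PS φ e b ∘ₗ PL φ e b
  have hE : ∀ x, E x = DD φ e a x + PS φ e b (PL φ e b x) := fun x => rfl
  let J : (Fx φ m × L) →ₗ[k0 φ] A :=
    LinearMap.coprod (Fx φ m).subtype (muL φ θ ∘ₗ L.subtype)
  have hJ : ∀ p : Fx φ m × L, J p = (p.1 : A) + θ * (p.2 : A) := fun p => rfl
  have hPLm : ∀ v ∈ L, PL φ e b (θ * v) ∈ Fx φ m := by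
    intro v hv
    apply mem_of_N
    rw [← PL_ph φ hb, ← map_add, Nth φ hθ1 (hL hv), hbL v hv]
  have hEJ : ∀ p, (E ∘ₗ J) p ∈ P := by
    intro p
    have hp1 : (p.1 : A) ∈ Fx φ m := p.1.2
    have hp2 : (p.2 : A) ∈ L := p.2.2
    have hM : PL φ e b (J p) ∈ Fx φ m := by
      rw [hJ, map_add]
      exact Submodule.add_mem _ (PL_mem φ hb hp1) (hPLm _ hp2)
    have hDm : DD φ e a (θ * (p.2 : A)) ∈ Fx φ m := thD φ ha hθ1 (hL hp2) (hLD _ hp2)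
    show E (J p) ∈ P
    rw [hE]
    apply hP2
    · refine Submodule.add_mem _ ?_ (PS_mem φ hb hM)
      rw [hJ, map_add]
      exact Submodule.add_mem _ (DD_mem φ ha hp1) hDm
    · intro u hu
      rw [mul_add, map_add, ← PL_adj φ hb (hL hu) hM, hbL u hu, zero_mul, map_zero, add_zero, hJ,
        map_add, mul_add, map_add, hiso u hu _ hp2, add_zero, ← DD_adj φ ha (hL hu) hp1,
        hLD u hu, zero_mul, map_zero]
  let G : (Fx φ m × L) →ₗ[k0 φ] P := LinearMap.codRestrict P (E ∘ₗ J) hEJ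
  have hJinj : Function.Injective J := by
    rw [← LinearMap.ker_eq_bot, LinearMap.ker_eq_bot']
    rintro ⟨y, l⟩ h
    have h' : (y : A) + θ * (l : A) = 0 := h
    have hy := y.2
    have hl := hL l.2
    have h1 : ph φ m ((y : A) + θ * (l : A)) + ((y : A) + θ * (l : A)) = l := by
      rw [map_add, (mem_Fx φ).1 hy]
      linear_combination Nth φ hθ1 hl + CharTwo.add_self_eq_zero (y : A)
    rw [h', map_zero, add_zero] at h1
    have hl0 : l = 0 := Subtype.ext h1.symm
    have hy0 : y = 0 := Subtype.ext (by
      rw [← h1, mul_zero, add_zero] at h'; exact h')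
    rw [hl0, hy0]; rfl
  have hfr := LinearMap.finrank_range_add_finrank_ker G
  rw [Module.finrank_prod, Fx_fr φ hφ hk hm, hLe] at hfr
  have hrg := Submodule.finrank_le (LinearMap.range G)
  have hS := (Submodule.equivMapOfInjective J hJinj (LinearMap.ker G)).finrank_eq
  have hz := DD_zero φ hφ hk e he (fun i => a i + aR φ e b i) ((PS φ e b 1) ^ 2)
    (by simp only [aR_top, ← hbe, CharTwo.add_self_eq_zero])
    ((LinearMap.ker G).map J) (by
      rintro _ ⟨p, hp, rfl⟩
      have : E (J p) = 0 := congrArg Subtype.val (LinearMap.mem_ker.1 hp)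
      rw [hE, FF_eq] at this
      rw [DD_add, add_assoc]; exact this) (by omega)
  refine ⟨fun r h1 h2 => CharTwo.add_eq_zero.1 (hz.1 r h1 h2), ?_⟩
  exact pow_eq_zero_iff (by norm_num) |>.1 hz.2

theorem bwd (hφ : ∀ x, ph φ 1 x = x ^ 2 ^ k) (hk : 1 ≤ k) {m : ℕ} (hm : 1 ≤ m) (e : ℕ)
    (he : 1 ≤ e) (a : ℕ → A) (ha : ∀ i, a i ∈ Fx φ m) (hae : a e ≠ 0)
    (hV : ∀ u, DD φ e a u = 0 → u ∈ Fx φ (2 * m))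
    (hTr : ∀ u, DD φ e a u = 0 → TT φ (2 * m) ((ph φ m u + u) * PL φ e a u) = 0) :
    ∃ b : ℕ → A, (∀ i, b i ∈ Fx φ m) ∧ ∃ t ∈ Fx φ m, b 0 * b e ≠ 0 ∧ PS φ e b 1 = 0 ∧
      (∀ x, PS φ e b x = 0 → x ∈ Fx φ m) ∧ (∀ r, 1 ≤ r → r ≤ e → a r = aR φ e b r) ∧
      a 0 = gam φ e b + (PS φ e b t) ^ 2 := by
  obtain ⟨θ, hθ, hθ1⟩ := exists_theta φ hφ hk hm
  obtain ⟨L, hL, hLD, hiso, hQ, hLe⟩ := exists_L φ hφ hk hm e he a ha hae hθ hθ1 hV hTr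
  obtain ⟨c, hc, hc0, hce, hcL⟩ := exists_F φ hφ hk e he L hL
    ((Fx_fin φ hφ hk hm).subset fun x hx => hL hx) hLe
  have hcc : c 0 * c e ≠ 0 := mul_ne_zero hc0 hce
  obtain ⟨d, hd, hd2⟩ := exists_sq φ (n := m) (x := a e / (c 0 * c e)) (by
    rw [mem_Fx, map_div₀, map_mul (ph φ m), (mem_Fx φ).1 (ha e), (mem_Fx φ).1 (hc 0),
      (mem_Fx φ).1 (hc e)])
  have hd0 : d ≠ 0 := by
    rintro rfl
    rw [zero_pow (by norm_num)] at hd2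
    exact (div_ne_zero hae hcc) hd2.symm
  set b : ℕ → A := fun i => d * c i with hbdef
  have hb : ∀ i, b i ∈ Fx φ m := fun i => mul_mem_Fx φ hd (hc i)
  have hb0 : b 0 ≠ 0 := mul_ne_zero hd0 hc0
  have hbe : b e ≠ 0 := mul_ne_zero hd0 hce
  have hbk : ∀ v, PL φ e b v = 0 ↔ v ∈ L := by
    intro v
    rw [hbdef, PL_scale, ← hcL, LinearMap.mem_ker]
    simp [hd0]
  have hbb : a e = b 0 * b e := by
    have : b 0 * b e = d ^ 2 * (c 0 * c e) := by simp only [hbdef]; ring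
    rw [this, hd2, div_mul_cancel₀ _ hcc]
  obtain ⟨har, hb1⟩ := coef_eq φ hφ hk hm e he a ha hθ1 L hL hLD hiso hLe b hb
    (fun v hv => (hbk v).2 hv) hbb
  have hker : LinearMap.ker (PS φ e b) ≤ Fx φ m :=
    (ker_iff φ hφ hk hm e b hb hb0 hbe).2 fun v hv => hL ((hbk v).1 hv)
  obtain ⟨z, hz, hz2⟩ := exists_sq φ (n := m) (x := a 0 + gam φ e b)
    (Submodule.add_mem _ (ha 0) (gam_mem φ hb))
  obtain ⟨t, ht, htz⟩ := (pair_fr φ hφ hk hm (PL φ e b) (PS φ e b) (fun x hx => PL_mem φ hb hx)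
    (fun x hx => PS_mem φ hb hx) (fun x hx y hy => PL_adj φ hb hx hy)).2 z hz (by
      intro v hv hv0
      have h1 := hQ v ((hbk v).1 hv0)
      rw [key2 φ m e a b hb har hb1 hv hv0, ← hz2, ← mul_pow, TT_sq] at h1
      rw [mul_comm]
      exact pow_eq_zero_iff (by norm_num) |>.1 h1)
  refine ⟨b, hb, t, ht, mul_ne_zero hb0 hbe, hb1, fun x hx => hker hx, har, ?_⟩
  rw [htz, hz2]
  linear_combination -CharTwo.add_self_eq_zero (gam φ e b)

end backward

section transfer

theorem rt_pow (L : Type*) [Field L] [ExpChar L 2] [PerfectRing L 2] (j : ℕ) (x : L) :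
    rt L j x ^ 2 ^ j = x := by
  induction j with
  | zero => simp [rt]
  | succ n ih =>
    have h : rt L (n + 1) x = (frobeniusEquiv L 2).symm (rt L n x) := by
      simp only [rt, Function.iterate_succ_apply']
    rw [h, pow_succ', pow_mul, frobeniusEquiv_symm_pow_p, ih]

theorem pow2_inj (L : Type*) [Field L] [ExpChar L 2] [PerfectRing L 2] (j : ℕ) {x y : L}
    (h : x ^ 2 ^ j = y ^ 2 ^ j) : x = y := by
  apply (iterateFrobeniusEquiv L 2 j).injective
  rw [iterateFrobeniusEquiv_apply, iterateFrobeniusEquiv_apply]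
  exact h

theorem rt_map {K L : Type*} [Field K] [ExpChar K 2] [PerfectRing K 2] [Field L] [ExpChar L 2]
    [PerfectRing L 2] (f : K →+* L) (j : ℕ) (x : K) : f (rt K j x) = rt L j (f x) := by
  apply pow2_inj L j
  rw [rt_pow, ← map_pow, rt_pow]

/-- the automorphism `x ↦ x^(2^k)` -/
def frA (L : Type*) [Field L] [ExpChar L 2] [PerfectRing L 2] (k : ℕ) : RingAut L :=
  iterateFrobeniusEquiv L 2 k

variable {A : Type*} [Field A] [ExpChar A 2] [PerfectRing A 2]

theorem frA_spec (k : ℕ) (x : A) : ph (frA A k) 1 x = x ^ 2 ^ k := by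
  rw [ph_one]; exact iterateFrobeniusEquiv_apply A 2 k x

theorem rt_ph (k i : ℕ) (x : A) : rt A (k * i) x = ph (frA A k) (-i) x := by
  apply pow2_inj A (k * i)
  rw [rt_pow, pow_mul, ← ph_nat _ (frA_spec k), ph_cancel_neg]

theorem Lpoly_PL (k e : ℕ) (c : ℕ → A) (x : A) : Lpoly (2 ^ k) e c x = PL (frA A k) e c x := by
  rw [Lpoly, PL_apply]
  exact Finset.sum_congr rfl fun i _ => by rw [ph_nat _ (frA_spec k)]

theorem adj_PS (k e : ℕ) (c : ℕ → A) (x : A) : adj k e c x = PS (frA A k) e c x := by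
  rw [adj, PS_apply]
  exact Finset.sum_congr rfl fun i _ => by rw [rt_ph]

theorem trp_TT (k n : ℕ) (x : A) : trp (2 ^ k) n x = TT (frA A k) n x := by
  rw [trp, TT_apply]
  exact Finset.sum_congr rfl fun i _ => by rw [ph_nat _ (frA_spec k)]

variable {K : Type*} [Field K] [ExpChar K 2] [PerfectRing K 2] (f : K →+* A)

theorem aRF_aR (k e : ℕ) (b : ℕ → K) (i : ℕ) :
    f (aRF k e b i) = aR (frA A k) e (fun i => f (b i)) i := by
  rw [aRF, aR, map_sum]
  exact Finset.sum_congr rfl fun j _ => by rw [rt_map f, rt_ph, map_mul]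

theorem adj_map (k e : ℕ) (b : ℕ → K) (t : K) :
    f (adj k e b t) = PS (frA A k) e (fun i => f (b i)) (f t) := by
  rw [adj, PS_apply, map_sum]
  exact Finset.sum_congr rfl fun j _ => by rw [rt_map f, rt_ph, map_mul]

theorem alphaF_map (k e : ℕ) (b : ℕ → K) (t : K) :
    f (alphaF k e b t) = gam (frA A k) e (fun i => f (b i)) +
      PS (frA A k) e (fun i => f (b i)) (f t) ^ 2 := by
  rw [alphaF, map_add, map_pow, adj_map, gammaF, gam, S2_Ioo, map_sum]
  congr 1
  refine Finset.sum_congr rfl fun i _ => ?_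
  rw [map_sum]
  refine Finset.sum_congr rfl fun j _ => ?_
  rw [map_mul, rt_map f, rt_map f, rt_ph, rt_ph]

theorem mem_Fx_iff [IsAlgClosed A] [CharP A 2] [Fintype K] (k m : ℕ) (hk : 1 ≤ k) (hm : 1 ≤ m)
    (hcard : Fintype.card K = 2 ^ (k * m)) (x : A) : x ∈ Fx (frA A k) m ↔ x ∈ Set.range f := by
  have h1 : Set.range f ⊆ (Fx (frA A k) m : Set A) := by
    rintro _ ⟨y, rfl⟩
    show f y ∈ Fx (frA A k) m
    rw [mem_Fx, ph_nat _ (frA_spec k), ← pow_mul, ← hcard, ← map_pow, FiniteField.pow_card]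
  have hfin := Fx_fin (frA A k) (frA_spec k) hk hm
  have h2 := card_fr (frA A k) (frA_spec k) hk _ hfin
  rw [Fx_fr (frA A k) (frA_spec k) hk hm, ← pow_mul, ← hcard] at h2
  have h3 : (Set.range f).ncard = Fintype.card K := by
    rw [← Set.image_univ, Set.ncard_image_of_injective _ f.injective, Set.ncard_univ,
      Nat.card_eq_fintype_card]
  have h4 := Set.eq_of_subset_of_ncard_le h1 (by rw [h2, h3]) hfin
  rw [h4]; rfl

end transfer

/-- Characterisation of the `R` of the form `R_{F,t}`. -/
theorem statement6 {K : Type*} [Field K] [Fintype K] [CharP K 2]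
    (k m e : ℕ) (hk : 1 ≤ k) (hm : 1 ≤ m) (he : 1 ≤ e)
    (hcard : Fintype.card K = 2 ^ (k * m))
    (a : ℕ → K) (hae : a e ≠ 0) :
    (∃ b : ℕ → K, ∃ t : K,
        b 0 * b e ≠ 0 ∧
        adjBar k e b 1 = 0 ∧
        (∀ x : AlgebraicClosure K, adjBar k e b x = 0 →
          x ∈ Set.range (algebraMap K (AlgebraicClosure K))) ∧
        (∀ i ∈ Finset.Icc 1 e, a i = aRF k e b i) ∧
        a 0 = alphaF k e b t) ↔
      ((∀ u : AlgebraicClosure K,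
          Lpoly (2 ^ k) e (fun i => algebraMap K (AlgebraicClosure K) (a i)) u
              + adj k e (fun i => algebraMap K (AlgebraicClosure K) (a i)) u = 0 →
            u ^ (2 ^ (k * m)) ^ 2 = u) ∧
        (∀ u : AlgebraicClosure K,
          Lpoly (2 ^ k) e (fun i => algebraMap K (AlgebraicClosure K) (a i)) u
              + adj k e (fun i => algebraMap K (AlgebraicClosure K) (a i)) u = 0 →
            trp (2 ^ k) (2 * m)
              ((u ^ (2 ^ (k * m)) + u) *
                Lpoly (2 ^ k) e (fun i => algebraMap K (AlgebraicClosure K) (a i)) u) = 0)) := by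
  set f := algebraMap K (AlgebraicClosure K) with hf
  have hfi : Function.Injective f := f.injective
  have hφ := frA_spec (A := AlgebraicClosure K) k
  have hmem := mem_Fx_iff f k m hk hm hcard
  have ha : ∀ i, f (a i) ∈ Fx (frA (AlgebraicClosure K) k) m := fun i => (hmem _).2 ⟨_, rfl⟩
  have hq : ∀ u : AlgebraicClosure K,
      u ^ (2 ^ (k * m)) ^ 2 = u ↔ u ∈ Fx (frA (AlgebraicClosure K) k) (2 * m) := by
    intro u
    rw [mem_Fx, ph_nat _ hφ, ← pow_mul, ← pow_mul, show k * m * 2 = k * (2 * m) by ring]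
  have hq1 : ∀ u : AlgebraicClosure K,
      u ^ (2 ^ (k * m)) = ph (frA (AlgebraicClosure K) k) m u := by
    intro u
    rw [ph_nat _ hφ, ← pow_mul]
  simp only [hq, hq1, Lpoly_PL, adj_PS, trp_TT, R_eq_DD]
  constructor
  · rintro ⟨b, t, h0e, hb1, hker, har, ha0⟩
    have key := fwd (frA (AlgebraicClosure K) k) hφ hk hm e (fun i => f (a i)) ha
      (fun i => f (b i)) (fun i => (hmem _).2 ⟨_, rfl⟩) (f t) ((hmem _).2 ⟨_, rfl⟩)
      (by rw [← map_mul]; exact (map_ne_zero f).2 h0e)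
      (by rw [← adj_PS]; exact hb1)
      (fun x hx => (hmem x).2 (hker x (by rw [adjBar, adj_PS]; exact hx)))
      (fun r h1 h2 => by
        rw [har r (Finset.mem_Icc.2 ⟨h1, h2⟩), aRF_aR])
      (by rw [ha0, alphaF_map])
    exact ⟨fun u hu => (key u hu).1, fun u hu => (key u hu).2⟩
  · rintro ⟨hV, hTr⟩
    obtain ⟨b, hb, t, ht, h0e, hb1, hker, har, ha0⟩ :=
      bwd (frA (AlgebraicClosure K) k) hφ hk hm e he (fun i => f (a i)) ha
        ((map_ne_zero f).2 hae) hV hTr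
    choose c hc using fun i => (hmem _).1 (hb i)
    obtain ⟨s, rfl⟩ := (hmem _).1 ht
    obtain rfl : (fun i => f (c i)) = b := funext hc
    refine ⟨c, s, ?_, ?_, ?_, ?_, ?_⟩
    · rw [← map_mul] at h0e
      exact (map_ne_zero f).1 h0e
    · rw [adjBar, adj_PS]; exact hb1
    · intro x hx
      rw [adjBar, adj_PS] at hx
      exact (hmem x).1 (hker x hx)
    · intro i hi
      apply hfi
      rw [aRF_aR]
      exact har i (Finset.mem_Icc.1 hi).1 (Finset.mem_Icc.1 hi).2
    · apply hfi
      rw [alphaF_map]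
      exact ha0

end
end

section
/- Let R(x) = ∑_{i=1}^e a_i x^{p^i} ∈ F_q[x] with e ≥ 1 and a_e ≠ 0, and assume that every u ∈ 𝔽 with R(u) + R*(u) = 0 lies in F_q. Then there exist b_0,…,b_e ∈ F_q with b_0·b_e ≠ 0 such that, writing F(x) := ∑_{i=0}^e b_i x^{p^i}, one has: F*(1) = 0; {x ∈ 𝔽 : F*(x) = 0} ⊆ F_q; {x ∈ 𝔽 : F*(F(x)) = 0} ⊆ F_q; and a_i = ∑_{j=0}^{e−i}(b_j b_{j+i})^{p^{−j}} for all 1 ≤ i ≤ e. -/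
open Finset

open scoped Classical

noncomputable section

variable {K : Type*}

section helpers7

open Polynomial

variable {L : Type*} [Field L]

/-- The symmetric operator with coefficients `a_0, …, a_N`. -/
def symB (s : L ≃+* L) (N : ℕ) (a : ℕ → L) (x : L) : L :=
  a 0 * x + ∑ i ∈ range N, (a (i + 1) * (s ^ ((i : ℤ) + 1)) x
    + (s ^ (-((i : ℤ) + 1))) (a (i + 1) * x))

/-- The autocorrelation coefficients. -/
def symA (s : L ≃+* L) (N : ℕ) (b : ℕ → L) (i : ℕ) : L :=
  ∑ j ∈ range N, (s ^ (-(j : ℤ))) (b j * b (j + i))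

theorem szz (s : L ≃+* L) (m n : ℤ) (x : L) : (s ^ m) ((s ^ n) x) = (s ^ (m + n)) x := by
  rw [zpow_add]; rfl

theorem sz0 (s : L ≃+* L) (x : L) : (s ^ (0 : ℤ)) x = x := by
  rw [zpow_zero]; rfl

theorem exists_sol (s : L ≃+* L) (q : ℕ) (hq : 2 ≤ q)
    (hs : ∀ (n : ℕ) x, (s ^ (n : ℤ)) x = x ^ q ^ n) [IsAlgClosed L]
    (d : ℕ → L) (N : ℕ) (hdN : d N ≠ 0) (y : L) :
    ∃ x, ∑ i ∈ range (N + 1), d i * (s ^ (i : ℤ)) x = y := by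
  set P : L[X] := ∑ i ∈ range (N + 1), C (d i) * X ^ (q ^ i) - C y with hP
  have hc : P.coeff (q ^ N) = d N := by
    have h0 : q ^ N ≠ 0 := by positivity
    simp only [hP, coeff_sub, finsetSum_coeff, coeff_C_mul, coeff_X_pow, coeff_C, h0, if_false,
      sub_zero]
    rw [Finset.sum_eq_single N]
    · simp
    · intro i _ hi
      have : q ^ N ≠ q ^ i := fun h => hi (Nat.pow_right_injective hq h).symm
      simp [this]
    · simp
  have hdeg : P.degree ≠ 0 := by
    intro h
    have h1 := eq_C_of_degree_eq_zero h
    rw [h1, coeff_C, if_neg (by positivity)] at hc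
    exact hdN hc.symm
  obtain ⟨x, hx⟩ := IsAlgClosed.exists_root P hdeg
  refine ⟨x, ?_⟩
  simp only [hP, IsRoot.def, eval_sub, eval_finsetSum, eval_mul, eval_C, eval_pow, eval_X] at hx
  simp only [hs]
  exact sub_eq_zero.mp hx

theorem exists_ker (s : L ≃+* L) (q : ℕ) (hq : 2 ≤ q)
    (hs : ∀ (n : ℕ) x, (s ^ (n : ℤ)) x = x ^ q ^ n) [IsAlgClosed L]
    (d : ℕ → L) (N : ℕ) (hN : 1 ≤ N) (hdN : d N ≠ 0) (hd0 : d 0 ≠ 0) :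
    ∃ x, x ≠ 0 ∧ ∑ i ∈ range (N + 1), d i * (s ^ (i : ℤ)) x = 0 := by
  set P : L[X] := ∑ i ∈ range (N + 1), C (d i) * X ^ (q ^ i - 1) with hP
  have key : ∀ M, M ≤ N → P.coeff (q ^ M - 1) = d M := by
    intro M hM
    simp only [hP, finsetSum_coeff, coeff_C_mul, coeff_X_pow]
    rw [Finset.sum_eq_single M]
    · simp
    · intro i _ hi
      have h2 : q ^ M ≠ q ^ i := fun h => hi (Nat.pow_right_injective hq h).symm
      have h3 : 0 < q ^ M := by positivity
      have h4 : 0 < q ^ i := by positivity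
      have : q ^ M - 1 ≠ q ^ i - 1 := by omega
      simp [this]
    · intro h; simp at h; omega
  have hdeg : P.degree ≠ 0 := by
    intro h
    have h1 := eq_C_of_degree_eq_zero h
    have hc := key N le_rfl
    have : 1 < q ^ N := Nat.one_lt_pow (by omega) (by omega)
    rw [h1, coeff_C, if_neg (by omega)] at hc
    exact hdN hc.symm
  obtain ⟨x, hx⟩ := IsAlgClosed.exists_root P hdeg
  refine ⟨x, ?_, ?_⟩
  · rintro rfl
    have := key 0 (by omega)
    rw [IsRoot.def, ← coeff_zero_eq_eval_zero] at hx
    simp at this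
    exact hd0 (this.symm.trans hx)
  · simp only [hP, IsRoot.def, eval_finsetSum, eval_mul, eval_C, eval_pow, eval_X] at hx
    have : ∑ i ∈ range (N + 1), d i * (s ^ (i : ℤ)) x
      = (∑ i ∈ range (N + 1), d i * x ^ (q ^ i - 1)) * x := by
      rw [Finset.sum_mul]
      refine Finset.sum_congr rfl fun i _ => ?_
      have h4 : 0 < q ^ i := by positivity
      rw [hs, mul_assoc, ← pow_succ, Nat.sub_add_cancel h4]
    rw [this, hx, zero_mul]

theorem symB_exists_ker (s : L ≃+* L) (q : ℕ) (hq : 2 ≤ q)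
    (hs : ∀ (n : ℕ) x, (s ^ (n : ℤ)) x = x ^ q ^ n) [IsAlgClosed L]
    (a : ℕ → L) (e : ℕ) (he : 1 ≤ e) (hae : a e ≠ 0) :
    ∃ x, x ≠ 0 ∧ symB s e a x = 0 := by
  set d : ℕ → L := fun j => if j < e then (s ^ (j : ℤ)) (a (e - j)) else (s ^ (e : ℤ)) (a (j - e))
    with hd
  obtain ⟨x, hx0, hx⟩ := exists_ker s q hq hs d (e + e) (by omega)
    (by
      simp only [hd]
      rw [if_neg (by omega), Nat.add_sub_cancel]
      exact (map_ne_zero_iff _ (s ^ (e : ℤ)).injective).mpr hae) (by simp [hd, hae, show 0 < e by omega])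
  refine ⟨x, hx0, ?_⟩
  have : (s ^ (e : ℤ)) (symB s e a x) = 0 := by
    rw [← hx, show e + e + 1 = e + (e + 1) by ring, Finset.sum_range_add, ← Finset.sum_range_reflect]
    rw [Finset.sum_range_succ']
    simp only [symB, map_add, map_mul, map_sum, szz, Finset.sum_add_distrib]
    have h1 : ∀ j ∈ range e, d (e - 1 - j) * (s ^ ((e - 1 - j : ℕ) : ℤ)) x
        = (s ^ ((e : ℤ) + -((j : ℤ) + 1))) (a (j + 1)) * (s ^ ((e : ℤ) + -((j : ℤ) + 1))) x := by
      intro j hj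
      have hj := Finset.mem_range.mp hj
      have h2 : ((e - 1 - j : ℕ) : ℤ) = (e : ℤ) + -((j : ℤ) + 1) := by omega
      simp only [hd]
      rw [if_pos (by omega), h2, show e - (e - 1 - j) = j + 1 by omega]
    rw [Finset.sum_congr rfl h1]
    have h3 : ∀ j ∈ range e, d (e + (j + 1)) * (s ^ ((e + (j + 1) : ℕ) : ℤ)) x
        = (s ^ (e : ℤ)) (a (j + 1)) * (s ^ ((e : ℤ) + ((j : ℤ) + 1))) x := by
      intro j hj
      simp only [hd]
      rw [if_neg (by omega), show e + (j + 1) - e = j + 1 by omega]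
      push_cast; rfl
    rw [Finset.sum_congr rfl h3]
    simp only [hd, add_zero, lt_irrefl, if_false, Nat.sub_self]
    ring
  exact (map_eq_zero_iff _ (s ^ (e : ℤ)).injective).mp this

theorem exists_descent (t : L ≃+* L) [CharP L 2] : ∀ (n : ℕ) (a : ℕ → L), (∀ i, n + 1 < i → a i = 0) →
    ∀ S : Subfield L, (∀ x ∈ S, t x ∈ S) → (∀ i, a i ∈ S) →
    ∃ a' : ℕ → L, (∀ i, a' i ∈ S) ∧ (∀ i, n < i → a' i = 0) ∧ a' n = a (n + 1) ∧
      ∀ i, a (i + 1) = t (a' (i + 1)) + a' (i + 1) + a' i + t (a' (i + 2)) := by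
  intro n
  induction n with
  | zero =>
    intro a ha S hS haS
    refine ⟨fun i => if i = 0 then a 1 else 0, ?_, ?_, ?_, ?_⟩
    · intro i; dsimp only; split_ifs
      · exact haS 1
      · exact S.zero_mem
    · intro i hi; simp [show i ≠ 0 by omega]
    · simp
    · intro i
      rcases i with _ | i
      · simp
      · simp [ha (i + 1 + 1) (by omega)]
  | succ n ih =>
    intro a ha S hS haS
    obtain ⟨a', h1, h2, h3, h4⟩ := ih (fun i => a (i + 1)) (fun i hi => ha _ (by omega)) S hS
      (fun i => haS _)
    refine ⟨fun i => Nat.casesOn i (a 1 + t (a' 0) + a' 0 + t (a' 1)) a', ?_, ?_, ?_, ?_⟩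
    · rintro (_ | i)
      · exact S.add_mem (S.add_mem (S.add_mem (haS 1) (hS _ (h1 _))) (h1 _)) (hS _ (h1 _))
      · exact h1 i
    · rintro (_ | i) hi
      · omega
      · exact h2 i (by omega)
    · exact h3
    · rintro (_ | i)
      · show a 1 = t (a' 0) + a' 0 + (a 1 + t (a' 0) + a' 0 + t (a' 1)) + t (a' 1)
        linear_combination -CharTwo.add_self_eq_zero (t (a' 0)) - CharTwo.add_self_eq_zero (a' 0)
          - CharTwo.add_self_eq_zero (t (a' 1))
      · exact h4 i

theorem telescope2 [CharP L 2] (f g D : ℕ → L) (h : ∀ i, f i + g i = D (i + 1) + D i) (N : ℕ) :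
    ∑ i ∈ range N, f i + ∑ i ∈ range N, g i = D N + D 0 := by
  induction N with
  | zero => simp [CharTwo.add_self_eq_zero]
  | succ N ih =>
    rw [Finset.sum_range_succ, Finset.sum_range_succ]
    linear_combination ih + h N + CharTwo.add_self_eq_zero (D N)

theorem symB_descent [CharP L 2] (s : L ≃+* L) (N : ℕ) (a a' : ℕ → L)
    (ha0 : ∀ i, N ≤ i → a' i = 0)
    (ha : ∀ i, a (i + 1) = (s ^ (-1 : ℤ)) (a' (i + 1)) + a' (i + 1) + a' i
      + (s ^ (-1 : ℤ)) (a' (i + 2))) (x : L) :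
    symB s N a x + ((s ^ (-1 : ℤ)) (symB s N a' ((s ^ (1 : ℤ)) x + x))
      + symB s N a' ((s ^ (1 : ℤ)) x + x))
      = (a 0 + (s ^ (-1 : ℤ)) (a' 0) + a' 0) * x := by
  have h2 : (2 : L) = 0 := CharTwo.two_eq_zero
  set t : L ≃+* L := s ^ (-1 : ℤ) with ht
  have e1 := telescope2 (fun i => a (i + 1) * (s ^ ((i : ℤ) + 1)) x)
    (fun i => t (a' (i + 1) * (s ^ ((i : ℤ) + 1)) ((s ^ (1 : ℤ)) x + x))
      + a' (i + 1) * (s ^ ((i : ℤ) + 1)) ((s ^ (1 : ℤ)) x + x))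
    (fun i => a' i * (s ^ ((i : ℤ) + 1)) x + t (a' (i + 1)) * (s ^ (i : ℤ)) x)
    (by
      intro i
      simp only [ha, ht, map_add, map_mul, szz]
      push_cast
      ring_nf
      simp only [h2, mul_zero, add_zero, zero_add]
      try ring) N
  have e2 := telescope2 (fun i => (s ^ (-((i : ℤ) + 1))) (a (i + 1) * x))
    (fun i => t ((s ^ (-((i : ℤ) + 1))) (a' (i + 1) * ((s ^ (1 : ℤ)) x + x)))
      + (s ^ (-((i : ℤ) + 1))) (a' (i + 1) * ((s ^ (1 : ℤ)) x + x)))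
    (fun i => (s ^ (-((i : ℤ) + 1))) (a' (i + 1)) * (s ^ (-(i : ℤ))) x
      + (s ^ (-((i : ℤ) + 1))) (a' i) * (s ^ (-((i : ℤ) + 1))) x)
    (by
      intro i
      simp only [ha, ht, map_add, map_mul, szz]
      push_cast
      ring_nf
      simp only [h2, mul_zero, add_zero, zero_add]
      try ring) N
  simp only [ha0 N le_rfl, ha0 (N + 1) (by omega), map_zero, zero_mul, add_zero, zero_add,
    Finset.sum_add_distrib, Nat.cast_zero, neg_zero, sz0] at e1 e2
  simp only [symB, map_add, map_sum, Finset.sum_add_distrib, map_mul] at e1 e2 ⊢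
  simp only [ht, szz] at e1 e2 ⊢
  norm_num [sz0] at e1 e2 ⊢
  linear_combination e1 + e2 + (a' 0 * s x + (s⁻¹) (a' 0) * (s⁻¹) x + (s⁻¹) (a' 1) * x) * h2

theorem symA_succ [CharP L 2] (s : L ≃+* L) (N : ℕ) (b b' : ℕ → L)
    (hN : ∀ i, N ≤ i → b' i = 0)
    (h0 : b 0 = b' 0) (hb : ∀ i, b (i + 1) = b' i + b' (i + 1)) (i : ℕ) :
    symA s (N + 1) b (i + 1) = (s ^ (-1 : ℤ)) (symA s N b' (i + 1)) + symA s N b' (i + 1)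
      + symA s N b' i + (s ^ (-1 : ℤ)) (symA s N b' (i + 2)) := by
  have hA : ∀ i, symA s N b' i = symA s (N + 1) b' i := by
    intro i
    simp [symA, Finset.sum_range_succ, hN N le_rfl]
  rw [hA i]
  have h1 : (s ^ (-1 : ℤ)) (symA s N b' (i + 1)) + symA s N b' (i + 1)
      = (s ^ (-1 : ℤ)) (symA s N b' (i + 1)) + symA s (N + 1) b' (i + 1) := by rw [← hA]
  rw [h1]
  simp only [symA, Finset.sum_range_succ', map_sum, szz, h0]
  have h3 : ∀ j ∈ range N, (s ^ (-((j + 1 : ℕ) : ℤ))) (b (j + 1) * b (j + 1 + (i + 1)))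
     = (s ^ (-1 + -(j : ℤ))) (b' j * b' (j + (i + 1)))
      + (s ^ (-((j + 1 : ℕ) : ℤ))) (b' (j + 1) * b' (j + 1 + (i + 1)))
      + (s ^ (-((j + 1 : ℕ) : ℤ))) (b' (j + 1) * b' (j + 1 + i))
      + (s ^ (-1 + -(j : ℤ))) (b' j * b' (j + (i + 2))) := by
    intro j _
    rw [show -((j + 1 : ℕ) : ℤ) = -1 + -(j : ℤ) by push_cast; ring, ← map_add, ← map_add, ← map_add,
      hb, show j + 1 + (i + 1) = j + 1 + i + 1 by ring, hb (j + 1 + i),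
      show j + (i + 1) = j + 1 + i by ring, show j + (i + 2) = j + 1 + i + 1 by ring]
    congr 1
    ring
  rw [Finset.sum_congr rfl h3]
  simp only [Finset.sum_add_distrib, zero_add, hb i, Nat.cast_zero, neg_zero, sz0]
  ring

theorem symA_zero [CharP L 2] (s : L ≃+* L) (N : ℕ) (b b' : ℕ → L)
    (hN : ∀ i, N ≤ i → b' i = 0)
    (h0 : b 0 = b' 0) (hb : ∀ i, b (i + 1) = b' i + b' (i + 1)) :
    symA s (N + 1) b 0 = (s ^ (-1 : ℤ)) (symA s N b' 0) + symA s N b' 0 := by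
  have hA : symA s N b' 0 = symA s (N + 1) b' 0 := by
    simp [symA, Finset.sum_range_succ, hN N le_rfl]
  have h1 : (s ^ (-1 : ℤ)) (symA s N b' 0) + symA s N b' 0
      = (s ^ (-1 : ℤ)) (symA s N b' 0) + symA s (N + 1) b' 0 := by rw [← hA]
  rw [h1]
  simp only [symA, Finset.sum_range_succ', map_sum, szz, h0]
  have h3 : ∀ j ∈ range N, (s ^ (-((j + 1 : ℕ) : ℤ))) (b (j + 1) * b (j + 1 + 0))
     = (s ^ (-1 + -(j : ℤ))) (b' j * b' (j + 0))
      + (s ^ (-((j + 1 : ℕ) : ℤ))) (b' (j + 1) * b' (j + 1 + 0)) := by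
    intro j _
    rw [show -((j + 1 : ℕ) : ℤ) = -1 + -(j : ℤ) by push_cast; ring, ← map_add]
    simp only [add_zero, hb]
    congr 1
    linear_combination (b' j * b' (j + 1)) * (CharTwo.two_eq_zero : (2 : L) = 0)
  rw [Finset.sum_congr rfl h3]
  simp only [Finset.sum_add_distrib, Nat.cast_zero, neg_zero, sz0, add_zero, h0]
  ring

theorem zpow_mem7 (s : L ≃+* L) (S : Subfield L) (hS : ∀ x ∈ S, s x ∈ S)
    (n : ℕ) (x : L) (hx : x ∈ S) : (s ^ (n : ℤ)) x ∈ S := by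
  induction n with
  | zero => simpa [sz0] using hx
  | succ n ih =>
    have : (s ^ ((n + 1 : ℕ) : ℤ)) x = s ((s ^ (n : ℤ)) x) := by
      rw [Nat.cast_succ, add_comm, ← szz, zpow_one]
    rw [this]; exact hS _ ih

theorem main7 [CharP L 2] [IsAlgClosed L] (s : L ≃+* L) (q : ℕ) (hq : 2 ≤ q)
    (hs : ∀ (n : ℕ) x, (s ^ (n : ℤ)) x = x ^ q ^ n) (S : Subfield L)
    (hS : ∀ x ∈ S, s x ∈ S) (hS' : ∀ x ∈ S, (s ^ (-1 : ℤ)) x ∈ S)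
    (hsq : ∀ x ∈ S, ∃ y ∈ S, y * y = x) :
    ∀ (e : ℕ) (a : ℕ → L), (∀ i, a i ∈ S) → (∀ i, e < i → a i = 0) → a e ≠ 0 →
      (∀ u, symB s e a u = 0 → u ∈ S) →
      ∃ b : ℕ → L, (∀ i, b i ∈ S) ∧ (∀ i, e < i → b i = 0) ∧ b 0 ≠ 0 ∧ b e ≠ 0 ∧
        ∀ i, a i = symA s (e + 1) b i := by
  intro e
  induction e with
  | zero =>
    intro a haS ha0 hae _
    obtain ⟨y, hyS, hy⟩ := hsq _ (haS 0)
    have hy0 : y ≠ 0 := by rintro rfl; simp at hy; exact hae hy.symm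
    refine ⟨fun i => if i = 0 then y else 0, ?_, ?_, ?_, ?_, ?_⟩
    · intro i; dsimp only; split_ifs
      · exact hyS
      · exact S.zero_mem
    · intro i hi; simp [show i ≠ 0 by omega]
    · simpa using hy0
    · simpa using hy0
    · intro i
      rcases i with _ | i
      · simp only [symA, zero_add, Finset.sum_range_one, Nat.cast_zero, neg_zero, sz0, if_true, hy]
      · simp [symA, ha0 (i + 1) (by omega)]
  | succ n ih =>
    intro a haS ha0 hae hker
    obtain ⟨u, hu0, hu⟩ := symB_exists_ker s q hq hs a (n + 1) (by omega) hae
    have huS := hker u hu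
    have hsu0 : ∀ m : ℤ, (s ^ m) u ≠ 0 := fun m => (map_ne_zero_iff _ (s ^ m).injective).mpr hu0
    -- rescaled coefficients
    set α : ℕ → L := fun i => u * a i * (s ^ (i : ℤ)) u with hα
    have hαS : ∀ i, α i ∈ S := fun i =>
      S.mul_mem (S.mul_mem huS (haS i)) (zpow_mem7 s S hS i u huS)
    have hαB : ∀ x, symB s (n + 1) α x = u * symB s (n + 1) a (u * x) := by
      intro x
      simp only [symB, hα, mul_add, Finset.mul_sum]
      congr 1
      · simp [sz0]; ring
      · refine Finset.sum_congr rfl fun i _ => ?_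
        simp only [map_mul, szz]
        push_cast
        rw [neg_add_cancel, sz0]
        ring
    obtain ⟨a', ha'S, ha'0, ha'n, ha'⟩ := exists_descent (s ^ (-1 : ℤ)) n α
      (fun i hi => by simp [hα, ha0 i hi]) S hS' hαS
    have hid := symB_descent s (n + 1) α a' (fun i hi => ha'0 i (by omega)) ha'
    have hα0 : α 0 + (s ^ (-1 : ℤ)) (a' 0) + a' 0 = 0 := by
      have h := hid 1
      rw [hαB, mul_one, hu] at h
      simp only [map_one, CharTwo.add_self_eq_zero] at h
      simpa [symB] using h.symm
    have hsucc : ∀ x, symB s (n + 1) a' x = symB s n a' x := by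
      intro x
      simp [symB, Finset.sum_range_succ, ha'0 (n + 1) (by omega)]
    obtain ⟨b', hb'S, hb'0, hb'00, hb'n, hb'⟩ := ih a' ha'S ha'0
      (by
        rw [ha'n]
        exact mul_ne_zero (mul_ne_zero hu0 hae) (hsu0 _))
      (by
        intro x hx
        obtain ⟨y, hy⟩ := exists_sol s q hq hs (fun _ => 1) 1 one_ne_zero x
        have hy' : (s ^ (1 : ℤ)) y + y = x := by
          rw [← hy]; simp [Finset.sum_range_succ, add_comm]
        have h := hid y
        rw [hα0, hy', hsucc, hx, hαB] at h
        have h' : symB s (n + 1) a (u * y) = 0 := by simpa [hu0] using h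
        have hyS : y ∈ S := by
          have := S.mul_mem (S.inv_mem huS) (hker _ h')
          rwa [inv_mul_cancel_left₀ hu0] at this
        rw [← hy']
        exact S.add_mem (by simpa using hS _ hyS) hyS)
    set β : ℕ → L := fun i => Nat.casesOn i (b' 0) (fun i => b' i + b' (i + 1)) with hβ
    have hβ0 : β 0 = b' 0 := rfl
    have hβs : ∀ i, β (i + 1) = b' i + b' (i + 1) := fun i => rfl
    have hβA : ∀ i, α i = symA s (n + 2) β i := by
      rintro (_ | i)
      · rw [symA_zero s (n + 1) β b' (fun i hi => hb'0 i (by omega)) hβ0 hβs, ← hb']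
        linear_combination hα0 - CharTwo.add_self_eq_zero (a' 0)
          - CharTwo.add_self_eq_zero ((s ^ (-1 : ℤ)) (a' 0))
      · rw [symA_succ s (n + 1) β b' (fun i hi => hb'0 i (by omega)) hβ0 hβs]
        simp only [← hb']
        exact ha' i
    have hβS : ∀ i, β i ∈ S := by
      rintro (_ | i)
      · exact hb'S 0
      · exact S.add_mem (hb'S _) (hb'S _)
    refine ⟨fun i => β i * ((s ^ (i : ℤ)) u)⁻¹, ?_, ?_, ?_, ?_, ?_⟩
    · intro i
      exact S.mul_mem (hβS i) (S.inv_mem (zpow_mem7 s S hS i u huS))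
    · rintro (_ | i) hi
      · omega
      · simp [hβs, hb'0 i (by omega), hb'0 (i + 1) (by omega)]
    · exact mul_ne_zero hb'00 (inv_ne_zero (hsu0 _))
    · refine mul_ne_zero ?_ (inv_ne_zero (hsu0 _))
      rw [hβs, hb'0 (n + 1) (by omega), add_zero]
      exact hb'n
    · intro i
      have h1 : symA s (n + 1 + 1) (fun i => β i * ((s ^ (i : ℤ)) u)⁻¹) i
          = symA s (n + 2) β i * (u⁻¹ * ((s ^ (i : ℤ)) u)⁻¹) := by
        simp only [symA, Finset.sum_mul]
        refine Finset.sum_congr rfl fun j _ => ?_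
        simp only [map_mul, map_inv₀, szz]
        push_cast
        rw [neg_add_cancel, sz0, neg_add_cancel_left]
        ring
      rw [h1, ← hβA]
      simp only [hα]
      have := hsu0 i
      field_simp

theorem tail7 (e : ℕ) (g : ℕ → L) (hg : ∀ i, e < i → g i = 0) (j : ℕ) :
    ∑ i ∈ range (e + 1), (if j < i then g i else 0) = ∑ d ∈ range e, g (j + (d + 1)) := by
  have h1 : ∑ i ∈ range (e + 1), (if j < i then g i else 0)
      = ∑ i ∈ range (j + 1 + e), (if j < i then g i else 0) := by
    refine Finset.sum_subset (fun i hi => ?_) (fun i _ hi => ?_)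
    · simp only [Finset.mem_range] at hi ⊢; omega
    · simp only [Finset.mem_range] at hi
      simp [hg i (by omega)]
  rw [h1, Finset.sum_range_add, Finset.sum_eq_zero (s := range (j + 1)), zero_add]
  · refine Finset.sum_congr rfl fun d _ => ?_
    rw [if_pos (by omega), show j + 1 + d = j + (d + 1) by ring]
  · intro i hi
    simp only [Finset.mem_range] at hi
    rw [if_neg (by omega)]

/-- `F* ∘ F` as a symmetric operator. -/
theorem comp7 (s : L ≃+* L) (e : ℕ) (b : ℕ → L) (hb : ∀ i, e < i → b i = 0) (x : L) :
    ∑ j ∈ range (e + 1), (s ^ (-(j : ℤ))) (b j * ∑ i ∈ range (e + 1), b i * (s ^ (i : ℤ)) x)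
      = symB s e (symA s (e + 1) b) x := by
  set f : ℕ → ℕ → L := fun j i => (s ^ (-(j : ℤ))) (b j * b i * (s ^ (i : ℤ)) x) with hf
  have hf0 : ∀ j i, (e < j ∨ e < i) → f j i = 0 := by
    rintro j i (h | h) <;> simp [hf, hb _ h]
  have h1 : ∑ j ∈ range (e + 1), (s ^ (-(j : ℤ))) (b j * ∑ i ∈ range (e + 1), b i * (s ^ (i : ℤ)) x)
      = ∑ j ∈ range (e + 1), ∑ i ∈ range (e + 1), f j i := by
    simp only [hf, Finset.mul_sum, map_sum, mul_assoc]
  have hup : ∀ i, ∑ j ∈ range (e + 1), f j (j + i) = symA s (e + 1) b i * (s ^ (i : ℤ)) x := by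
    intro i
    simp only [symA, Finset.sum_mul, hf]
    refine Finset.sum_congr rfl fun j _ => ?_
    rw [map_mul, szz]
    push_cast
    rw [neg_add_cancel_left]
  have hdn : ∀ i, ∑ j ∈ range (e + 1), f (j + i) j = (s ^ (-(i : ℤ))) (symA s (e + 1) b i * x) := by
    intro i
    simp only [symA, Finset.sum_mul, hf, map_sum]
    refine Finset.sum_congr rfl fun j _ => ?_
    simp only [map_mul, szz]
    push_cast
    rw [show -((j : ℤ) + i) + j = -i by ring, show -((j : ℤ) + i) = -i + -j by ring]
    ring
  rw [h1]
  have hsplit : ∀ j i, f j i = (if j = i then f j i else 0)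
      + ((if j < i then f j i else 0) + (if i < j then f j i else 0)) := by
    intro j i
    rcases lt_trichotomy j i with h | h | h
    · simp [h, h.ne, h.not_gt]
    · simp [h]
    · simp [h, h.ne', h.not_gt]
  have e1 : ∑ j ∈ range (e + 1), ∑ i ∈ range (e + 1), (if j < i then f j i else 0)
      = ∑ d ∈ range e, ∑ j ∈ range (e + 1), f j (j + (d + 1)) := by
    rw [Finset.sum_comm (s := range e)]
    exact Finset.sum_congr rfl fun j _ => tail7 e (f j) (fun i hi => hf0 _ _ (Or.inr hi)) j
  have e2 : ∑ j ∈ range (e + 1), ∑ i ∈ range (e + 1), (if i < j then f j i else 0)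
      = ∑ d ∈ range e, ∑ j ∈ range (e + 1), f (j + (d + 1)) j := by
    rw [Finset.sum_comm (s := range e), Finset.sum_comm]
    exact Finset.sum_congr rfl fun j _ =>
      tail7 e (fun i => f i j) (fun i hi => hf0 _ _ (Or.inl hi)) j
  have e0 : ∑ j ∈ range (e + 1), ∑ i ∈ range (e + 1), (if j = i then f j i else 0)
      = ∑ j ∈ range (e + 1), f j (j + 0) := by
    refine Finset.sum_congr rfl fun j hj => ?_
    rw [Finset.sum_ite_eq, if_pos hj, add_zero]
  rw [Finset.sum_congr rfl fun j _ => Finset.sum_congr rfl fun i _ => hsplit j i]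
  simp only [Finset.sum_add_distrib]
  rw [e0, e1, e2]
  simp only [hup, hdn, symB, Finset.sum_add_distrib, Nat.cast_zero, sz0]
  push_cast
  rfl

end helpers7
theorem rt_eq7 {L : Type*} [Field L] [ExpChar L 2] [PerfectRing L 2] (k j : ℕ) (x : L) :
    rt L (k * j) x = ((iterateFrobeniusEquiv L 2 k) ^ (-(j : ℤ))) x := by
  rw [zpow_neg, zpow_natCast, iterateFrobeniusEquiv_eq_pow, ← pow_mul, ← inv_pow]
  unfold rt
  generalize k * j = n
  induction n generalizing x with
  | zero => rfl
  | succ n ih => rw [Function.iterate_succ_apply, ih, pow_succ]; rfl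

theorem sfrob7 {L : Type*} [Field L] [ExpChar L 2] [PerfectRing L 2] (k n : ℕ) (x : L) :
    ((iterateFrobeniusEquiv L 2 k) ^ (n : ℤ)) x = x ^ (2 ^ k) ^ n := by
  rw [zpow_natCast, iterateFrobeniusEquiv_eq_pow, ← pow_mul, ← iterateFrobeniusEquiv_eq_pow,
    iterateFrobeniusEquiv_def, ← pow_mul]

theorem rt_map7 {K L : Type*} [Field K] [Field L] [ExpChar K 2] [PerfectRing K 2]
    [ExpChar L 2] [PerfectRing L 2] (f : K →+* L) (j : ℕ) (x : K) :
    f (rt K j x) = rt L j (f x) := by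
  unfold rt
  induction j generalizing x with
  | zero => rfl
  | succ j ih =>
    rw [Function.iterate_succ_apply, Function.iterate_succ_apply, ih]
    congr 1
    exact f.map_frobeniusEquiv_symm 2 x

/-- If `ker(R + R^*) ⊆ 𝔽_q`, then `R = R_F` for some `F` satisfying
conditions (i)-(iv). -/
theorem statement7 {K : Type*} [Field K] [Fintype K] [CharP K 2]
    (k m e : ℕ) (hk : 1 ≤ k) (hm : 1 ≤ m) (he : 1 ≤ e)
    (hcard : Fintype.card K = 2 ^ (k * m))
    (c : ℕ → K) (hce : c e ≠ 0)
    (hV : ∀ u : AlgebraicClosure K,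
      LpolyIcc (2 ^ k) e (fun i => algebraMap K (AlgebraicClosure K) (c i)) u
          + adjIcc k e (fun i => algebraMap K (AlgebraicClosure K) (c i)) u = 0 →
        u ∈ Set.range (algebraMap K (AlgebraicClosure K))) :
    ∃ b : ℕ → K,
      b 0 * b e ≠ 0 ∧
      adjBar k e b 1 = 0 ∧
      (∀ x : AlgebraicClosure K, adjBar k e b x = 0 →
        x ∈ Set.range (algebraMap K (AlgebraicClosure K))) ∧
      (∀ x : AlgebraicClosure K, adjBar k e b (LpolyBar k e b x) = 0 →
        x ∈ Set.range (algebraMap K (AlgebraicClosure K))) ∧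
      ∀ i ∈ Finset.Icc 1 e, c i = aRF k e b i := by

  set Ω := AlgebraicClosure K with hΩ
  set φ : K →+* Ω := algebraMap K Ω with hφ
  set s : Ω ≃+* Ω := iterateFrobeniusEquiv Ω 2 k with hs
  have hrt : ∀ (j : ℕ) (x : Ω), rt Ω (k * j) x = (s ^ (-(j : ℤ))) x := rt_eq7 k
  have hpow : ∀ (n : ℕ) (x : Ω), (s ^ (n : ℤ)) x = x ^ (2 ^ k) ^ n := sfrob7 k
  have hq : 2 ≤ 2 ^ k := by
    calc 2 = 2 ^ 1 := rfl
      _ ≤ 2 ^ k := Nat.pow_le_pow_right (by norm_num) hk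
  set a : ℕ → Ω := fun i => if i = 0 then 0 else if i ≤ e then φ (c i) else 0 with ha
  have hasucc : ∀ i ∈ range e, a (i + 1) = φ (c (i + 1)) := by
    intro i hi
    have := Finset.mem_range.mp hi
    simp [ha, show i + 1 ≤ e by omega]
  have hB : ∀ u, symB s e a u = LpolyIcc (2 ^ k) e (fun i => φ (c i)) u
      + adjIcc k e (fun i => φ (c i)) u := by
    intro u
    unfold LpolyIcc adjIcc symB
    have hI : Finset.Icc 1 e = (range e).map (addRightEmbedding 1) := by
      ext i
      simp only [Finset.mem_Icc, Finset.mem_map, Finset.mem_range, addRightEmbedding_apply]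
      constructor
      · intro h; exact ⟨i - 1, by omega, by omega⟩
      · rintro ⟨j, h1, h2⟩; omega
    rw [hI, Finset.sum_map, Finset.sum_map, ← Finset.sum_add_distrib]
    have h0 : a 0 = 0 := by simp [ha]
    rw [h0, zero_mul, zero_add]
    refine Finset.sum_congr rfl fun i hi => ?_
    rw [hasucc i hi]
    simp only [addRightEmbedding_apply]
    rw [hrt, ← hpow]
    push_cast
    rfl
  have hmemS : ∀ x : Ω, x ∈ φ.fieldRange ↔ x ∈ Set.range φ := fun x => Iff.rfl
  obtain ⟨b, hbS, hb0, hb00, hbe, hb⟩ := main7 s (2 ^ k) hq hpow φ.fieldRange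
    (by
      rintro _ ⟨y, rfl⟩
      refine ⟨y ^ 2 ^ k, ?_⟩
      rw [map_pow]; rfl)
    (by
      rintro _ ⟨y, rfl⟩
      refine ⟨rt K (k * 1) y, ?_⟩
      rw [rt_map7, hrt]; rfl)
    (by
      rintro _ ⟨y, rfl⟩
      refine ⟨φ (rt K 1 y), ⟨_, rfl⟩, ?_⟩
      rw [← map_mul, ← pow_two]
      congr 1
      exact frobeniusEquiv_symm_pow_p K 2 y)
    e a
    (by
      intro i
      simp only [ha]
      split_ifs
      · exact Subfield.zero_mem _
      · exact ⟨_, rfl⟩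
      · exact Subfield.zero_mem _)
    (by
      intro i hi
      simp [ha, show ¬ i ≤ e by omega])
    (by
      simp only [ha]
      rw [if_neg (by omega), if_pos le_rfl]
      exact (map_ne_zero φ).mpr hce)
    (by
      intro u hu
      rw [hB] at hu
      exact hV u hu)
  choose β hβ using hbS
  have hβ' : (fun i => φ (β i)) = b := funext hβ
  have hadj : ∀ x, adjBar k e β x = ∑ j ∈ range (e + 1), (s ^ (-(j : ℤ))) (b j * x) := by
    intro x
    unfold adjBar adj
    refine Finset.sum_congr rfl fun j _ => ?_
    rw [hrt]
    exact congrArg (fun z => (s ^ (-(j : ℤ))) (z * x)) (hβ j)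
  have hL : ∀ x, LpolyBar k e β x = ∑ i ∈ range (e + 1), b i * (s ^ (i : ℤ)) x := by
    intro x
    unfold LpolyBar Lpoly
    refine Finset.sum_congr rfl fun j _ => ?_
    rw [hpow]
    exact congrArg (fun z => z * x ^ (2 ^ k) ^ j) (hβ j)
  have hcomp : ∀ x, adjBar k e β (LpolyBar k e β x) = symB s e a x := by
    intro x
    rw [hadj, hL, comp7 s e b hb0, ← funext hb]
  have hker : ∀ x : Ω, adjBar k e β (LpolyBar k e β x) = 0 → x ∈ Set.range φ := by
    intro x hx
    rw [hcomp, hB] at hx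
    exact hV x hx
  refine ⟨β, ?_, ?_, ?_, hker, ?_⟩
  · intro h
    have := congrArg φ h
    rw [map_mul, map_zero] at this
    have h1 : φ (β 0) = b 0 := hβ 0
    have h2 : φ (β e) = b e := hβ e
    rw [h1, h2] at this
    exact mul_ne_zero hb00 hbe this
  · have h0 : (0 : Ω) = symA s (e + 1) b 0 := by rw [← hb 0]; simp [ha]
    have h1 : adjBar k e β 1 ^ 2 = 0 := by
      rw [hadj, h0, CharTwo.sum_sq]
      unfold symA
      refine Finset.sum_congr rfl fun j _ => ?_
      rw [mul_one, add_zero, ← map_pow, pow_two]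
    exact pow_eq_zero_iff (two_ne_zero) |>.mp h1
  · intro y hy
    obtain ⟨x, hx⟩ := exists_sol s (2 ^ k) hq hpow b e hbe y
    rw [← hL] at hx
    rw [← hx] at hy ⊢
    obtain ⟨z, rfl⟩ := hker x hy
    refine ⟨Lpoly (2 ^ k) e β z, ?_⟩
    unfold LpolyBar Lpoly
    simp only [map_sum, map_mul, map_pow]
    rfl
  · intro i hi
    have hi' := Finset.mem_Icc.mp hi
    apply φ.injective
    have h1 : φ (c i) = a i := by
      simp [ha, show i ≠ 0 by omega, hi'.2]
    rw [h1, hb i]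
    unfold symA aRF
    rw [map_sum]
    symm
    have h2 : ∀ j, φ (rt K (k * j) (β j * β (j + i))) = (s ^ (-(j : ℤ))) (b j * b (j + i)) := by
      intro j
      rw [rt_map7, hrt, map_mul]
      have h1 : φ (β j) = b j := hβ j
      have h2 : φ (β (j + i)) = b (j + i) := hβ _
      rw [h1, h2]
    simp only [h2]
    refine Finset.sum_subset (fun j hj => ?_) (fun j _ hj => ?_)
    · simp only [Finset.mem_range] at hj ⊢; omega
    · simp only [Finset.mem_range] at hj
      rw [hb0 (j + i) (by omega), mul_zero, map_zero]

end
end
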